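/- Let G = (μ, X, Y, A, B, V) be a two-player one-round game whose question distribution is a product distribution, μ = μ_X ⊗ μ_Y, and suppose |A|·|B| ≥ 2. Then there exists a universal constant c > 0 such that for every integer k ≥ 1, ω*(G^k) ≤ (1 − (1 − ω*(G))³)^{c·k / log₂(|A|·|B|)}. -/

import Mathlib

open Matrix Kronecker
open scoped ComplexOrder

noncomputable section

/-- A two-player one-round game: a question distribution `μ` on `X × Y` and a
predicate `V` on questions and answers. (The requirement that `μ` is a genuine
probability distribution is stated as a hypothesis in the theorems.) -/
structure Game (X Y A B : Type) where
  μ : X × Y → ℝ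
  V : X → Y → A → B → Bool

/-- The winning probability of an entangled strategy, given by a shared unit vector
`ψ` on `ℂ^{dA} ⊗ ℂ^{dB}` and POVMs `{Al x a}_a` for Alice and `{Bo y b}_b` for Bob. -/
noncomputable def winProb {X Y A B : Type}
    [Fintype X] [Fintype Y] [Fintype A] [Fintype B] (G : Game X Y A B)
    {dA dB : ℕ} (ψ : Fin dA × Fin dB → ℂ)
    (Al : X → A → Matrix (Fin dA) (Fin dA) ℂ)
    (Bo : Y → B → Matrix (Fin dB) (Fin dB) ℂ) : ℝ :=
  ∑ x : X, ∑ y : Y, ∑ a : A, ∑ b : B,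
    G.μ (x, y) * (if G.V x y a b then 1 else 0) *
      (star ψ ⬝ᵥ ((Al x a ⊗ₖ Bo y b) *ᵥ ψ)).re

/-- The entangled value `ω*(G)`: the supremum of winning probabilities over all
entangled strategies (finite-dimensional shared entanglement and POVMs). -/
noncomputable def entangledValue {X Y A B : Type}
    [Fintype X] [Fintype Y] [Fintype A] [Fintype B] (G : Game X Y A B) : ℝ :=
  sSup { p : ℝ | ∃ (dA dB : ℕ) (ψ : Fin dA × Fin dB → ℂ)
    (Al : X → A → Matrix (Fin dA) (Fin dA) ℂ)
    (Bo : Y → B → Matrix (Fin dB) (Fin dB) ℂ),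
    star ψ ⬝ᵥ ψ = 1 ∧
    (∀ x a, (Al x a).PosSemidef) ∧ (∀ x, ∑ a : A, Al x a = 1) ∧
    (∀ y b, (Bo y b).PosSemidef) ∧ (∀ y, ∑ b : B, Bo y b = 1) ∧
    p = winProb G ψ Al Bo }

/-- The `k`-fold product game `G^k`. -/
def gamePow {X Y A B : Type} (G : Game X Y A B) (k : ℕ) :
    Game (Fin k → X) (Fin k → Y) (Fin k → A) (Fin k → B) where
  μ := fun p => ∏ i, G.μ (p.1 i, p.2 i)
  V := fun x y a b => decide (∀ i, G.V (x i) (y i) (a i) (b i) = true)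

-- sanity

set_option linter.unusedSectionVars false

section FC
variable {n : Type} [Fintype n] [DecidableEq n]

open Classical in
/-- eigenvalues (or `1` if not positive definite) -/
def evl (M : Matrix n n ℂ) : n → ℝ :=
  if h : M.PosDef then h.isHermitian.eigenvalues else fun _ => 1

open Classical in
/-- eigenvector unitary (or `1`) -/
def evu (M : Matrix n n ℂ) : Matrix n n ℂ :=
  if h : M.PosDef then (h.isHermitian.eigenvectorUnitary : Matrix n n ℂ) else 1

lemma evl_pos (M : Matrix n n ℂ) (i : n) : 0 < evl M i := by
  unfold evl
  split_ifs with h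
  · exact h.eigenvalues_pos i
  · exact one_pos

lemma evu_star_mul (M : Matrix n n ℂ) : (evu M)ᴴ * evu M = 1 := by
  unfold evu
  split_ifs with h
  · exact Unitary.coe_star_mul_self _
  · simp

lemma evu_mul_star (M : Matrix n n ℂ) : evu M * (evu M)ᴴ = 1 :=
  mul_eq_one_comm.mp (evu_star_mul M)

/-- functional calculus -/
def fc (M : Matrix n n ℂ) (f : ℝ → ℂ) : Matrix n n ℂ :=
  evu M * diagonal (fun i => f (evl M i)) * (evu M)ᴴ

lemma fc_mul (M : Matrix n n ℂ) (f g : ℝ → ℂ) : fc M f * fc M g = fc M (fun t => f t * g t) := by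
  unfold fc
  calc _ = evu M * diagonal (fun i => f (evl M i)) * ((evu M)ᴴ * evu M) *
        diagonal (fun i => g (evl M i)) * (evu M)ᴴ := by simp only [Matrix.mul_assoc]
    _ = _ := by
      rw [evu_star_mul, Matrix.mul_one, Matrix.mul_assoc (evu M), diagonal_mul_diagonal]

lemma fc_one (M : Matrix n n ℂ) : fc M (fun _ => 1) = 1 := by
  unfold fc
  rw [diagonal_one, Matrix.mul_one, evu_mul_star]

lemma fc_congr (M : Matrix n n ℂ) {f g : ℝ → ℂ} (h : ∀ t, 0 < t → f t = g t) :
    fc M f = fc M g := by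
  unfold fc
  congr 3
  ext i
  exact h _ (evl_pos M i)

lemma fc_id {M : Matrix n n ℂ} (h : M.PosDef) : fc M (fun t => (t : ℂ)) = M := by
  have := h.isHermitian.spectral_theorem
  unfold fc evu evl
  simp only [h, dite_true]
  conv_rhs => rw [this]
  rfl

lemma fc_star (M : Matrix n n ℂ) (f : ℝ → ℂ) : (fc M f)ᴴ = fc M (fun t => star (f t)) := by
  unfold fc
  simp only [conjTranspose_mul, conjTranspose_conjTranspose, diagonal_conjTranspose, Matrix.mul_assoc]
  rfl

lemma trace_fc (M : Matrix n n ℂ) (f : ℝ → ℂ) : trace (fc M f) = ∑ i, f (evl M i) := by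
  unfold fc
  rw [Matrix.trace_mul_comm, ← Matrix.mul_assoc, evu_star_mul, Matrix.one_mul, trace_diagonal]

/-- overlap weights -/
def ovl (M N : Matrix n n ℂ) (i j : n) : ℝ := Complex.normSq (((evu M)ᴴ * evu N) i j)

lemma ovl_nonneg (M N : Matrix n n ℂ) (i j : n) : 0 ≤ ovl M N i j := Complex.normSq_nonneg _

lemma trace_fc_mul_fc (M N : Matrix n n ℂ) (f g : ℝ → ℂ) :
    trace (fc M f * fc N g) = ∑ i, ∑ j, (ovl M N i j : ℂ) * (f (evl M i) * g (evl N j)) := by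
  have : trace (fc M f * fc N g) = trace (diagonal (fun i => f (evl M i)) * ((evu M)ᴴ * evu N) *
      (diagonal (fun i => g (evl N i)) * ((evu M)ᴴ * evu N)ᴴ)) := by
    unfold fc
    rw [show evu M * diagonal (fun i => f (evl M i)) * (evu M)ᴴ * (evu N * diagonal (fun i => g (evl N i)) * (evu N)ᴴ) = evu M * (diagonal (fun i => f (evl M i)) * (evu M)ᴴ * (evu N * diagonal (fun i => g (evl N i)) * (evu N)ᴴ)) by simp only [Matrix.mul_assoc], Matrix.trace_mul_comm (evu M)]
    simp only [Matrix.mul_assoc, conjTranspose_mul, conjTranspose_conjTranspose]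
  rw [this]
  unfold ovl
  generalize (evu M)ᴴ * evu N = W
  rw [trace]
  refine Finset.sum_congr rfl fun i _ => ?_
  rw [diag_apply, Matrix.mul_apply]
  refine Finset.sum_congr rfl fun j _ => ?_
  rw [diagonal_mul, diagonal_mul, conjTranspose_apply, ← Complex.mul_conj]
  simp only [starRingEnd_apply]
  ring

lemma ovl_sum_right (M N : Matrix n n ℂ) (i : n) : ∑ j, ovl M N i j = 1 := by
  have h : ((evu M)ᴴ * evu N) * ((evu M)ᴴ * evu N)ᴴ = 1 := by
    rw [conjTranspose_mul, conjTranspose_conjTranspose, Matrix.mul_assoc, ← Matrix.mul_assoc (evu N),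
      evu_mul_star, Matrix.one_mul, evu_star_mul]
  have h2 := congrFun (congrFun h i) i
  rw [Matrix.mul_apply, one_apply_eq] at h2
  have : ((∑ j, ovl M N i j : ℝ) : ℂ) = 1 := by
    rw [← h2]; push_cast
    exact Finset.sum_congr rfl fun j _ => (Complex.mul_conj _).symm
  exact_mod_cast this

lemma ovl_sum_left (M N : Matrix n n ℂ) (j : n) : ∑ i, ovl M N i j = 1 := by
  have h : ((evu M)ᴴ * evu N)ᴴ * ((evu M)ᴴ * evu N) = 1 := by
    rw [conjTranspose_mul, conjTranspose_conjTranspose, Matrix.mul_assoc, ← Matrix.mul_assoc (evu M),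
      evu_mul_star, Matrix.one_mul, evu_star_mul]
  have h2 := congrFun (congrFun h j) j
  rw [Matrix.mul_apply, one_apply_eq] at h2
  have : ((∑ i, ovl M N i j : ℝ) : ℂ) = 1 := by
    rw [← h2]; push_cast
    refine Finset.sum_congr rfl fun i _ => ?_
    rw [conjTranspose_apply, mul_comm]
    exact (Complex.mul_conj _).symm
  exact_mod_cast this

/-- complex powers -/
def pw (M : Matrix n n ℂ) (z : ℂ) : Matrix n n ℂ := fc M (fun t => Complex.exp (z * (Real.log t : ℂ)))

/-- logarithm -/
def lg (M : Matrix n n ℂ) : Matrix n n ℂ := fc M (fun t => (Real.log t : ℂ))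

lemma pw_zero (M : Matrix n n ℂ) : pw M 0 = 1 := by
  unfold pw; simp [fc_one]

lemma pw_add (M : Matrix n n ℂ) (z w : ℂ) : pw M (z + w) = pw M z * pw M w := by
  unfold pw
  rw [fc_mul]
  congr 1; ext t; rw [add_mul, Complex.exp_add]

lemma pw_one {M : Matrix n n ℂ} (h : M.PosDef) : pw M 1 = M := by
  conv_rhs => rw [← fc_id h]
  unfold pw
  refine fc_congr M fun t ht => ?_
  rw [one_mul, ← Complex.ofReal_exp, Real.exp_log ht]

lemma pw_star (M : Matrix n n ℂ) (z : ℂ) : (pw M z)ᴴ = pw M (star z) := by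
  unfold pw
  rw [fc_star]
  congr 1; ext t
  simp [← Complex.exp_conj]

lemma pw_isUnit (M : Matrix n n ℂ) (z : ℂ) : IsUnit (pw M z) := by
  have : pw M z * pw M (-z) = 1 := by rw [← pw_add, add_neg_cancel, pw_zero]
  exact IsUnit.of_mul_eq_one _ this

lemma pw_half_mul {M : Matrix n n ℂ} (h : M.PosDef) : pw M (1/2) * pw M (1/2) = M := by
  rw [← pw_add]; norm_num [pw_one h]

lemma pw_half_star (M : Matrix n n ℂ) : (pw M (1/2))ᴴ = pw M (1/2) := by
  rw [pw_star]; congr 1; simp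
end FC

section RT
variable {n : Type} [Fintype n] [DecidableEq n]

/-- real part of the trace -/
def rt (M : Matrix n n ℂ) : ℝ := (trace M).re

lemma rt_add (M N : Matrix n n ℂ) : rt (M + N) = rt M + rt N := by simp [rt]
lemma rt_sub (M N : Matrix n n ℂ) : rt (M - N) = rt M - rt N := by simp [rt]
lemma rt_smul (r : ℝ) (M : Matrix n n ℂ) : rt (r • M) = r * rt M := by simp [rt]
lemma rt_comm (M N : Matrix n n ℂ) : rt (M * N) = rt (N * M) := by simp [rt, Matrix.trace_mul_comm M N]
lemma rt_sum {ι : Type} (s : Finset ι) (f : ι → Matrix n n ℂ) : rt (∑ i ∈ s, f i) = ∑ i ∈ s, rt (f i) := by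
  simp [rt, trace_sum]

lemma rt_fc_mul_fc (M N : Matrix n n ℂ) (f g : ℝ → ℝ) :
    rt (fc M (fun t => (f t : ℂ)) * fc N (fun t => (g t : ℂ))) =
      ∑ i, ∑ j, ovl M N i j * (f (evl M i) * g (evl N j)) := by
  unfold rt
  rw [trace_fc_mul_fc]
  rw [show (∑ i, ∑ j, (ovl M N i j : ℂ) * ((f (evl M i) : ℂ) * (g (evl N j) : ℂ))) =
    ((∑ i, ∑ j, ovl M N i j * (f (evl M i) * g (evl N j)) : ℝ) : ℂ) by push_cast; rfl, Complex.ofReal_re]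

lemma pw_real (M : Matrix n n ℂ) (t : ℝ) :
    pw M (t : ℂ) = fc M (fun s => (Real.exp (t * Real.log s) : ℂ)) := by
  unfold pw; congr 1; ext s; push_cast; rfl

lemma fc_real_one (M : Matrix n n ℂ) : fc M (fun _ => ((1 : ℝ) : ℂ)) = 1 := by
  simpa using fc_one M

lemma scalar_close (a b θ : ℝ) (h0 : 0 ≤ θ) (h1 : θ ≤ 1) :
    Real.exp ((1 - θ) * a) * Real.exp (θ * b)
      - 2 * (Real.exp ((1 - θ/2) * a) * Real.exp (θ/2 * b)) + Real.exp a
    ≤ θ * (Real.exp b - Real.exp a) + θ * (Real.exp a * (a - b)) := by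
  have h2 : Real.exp ((1 - θ) * a) * Real.exp (θ * b) ≤ (1 - θ) * Real.exp a + θ * Real.exp b := by
    rw [← Real.exp_add]
    have := convexOn_exp.2 (Set.mem_univ a) (Set.mem_univ b) (sub_nonneg.2 h1) h0 (by ring)
    simpa using this
  have h3 : Real.exp a * (1 + θ/2 * (b - a)) ≤ Real.exp ((1 - θ/2) * a) * Real.exp (θ/2 * b) := by
    rw [← Real.exp_add, show (1 - θ/2) * a + θ/2 * b = a + θ/2 * (b - a) by ring, Real.exp_add]
    refine mul_le_mul_of_nonneg_left ?_ (Real.exp_pos _).le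
    linarith [Real.add_one_le_exp (θ/2 * (b - a))]
  nlinarith

lemma rt_close {M N : Matrix n n ℂ} (hM : M.PosDef) (hN : N.PosDef) (θ : ℝ) (h0 : 0 ≤ θ) (h1 : θ ≤ 1) :
    rt (pw M ((1 - θ : ℝ) : ℂ) * pw N (θ : ℂ)) - 2 * rt (pw M ((1 - θ/2 : ℝ) : ℂ) * pw N ((θ/2 : ℝ) : ℂ)) + rt M
     ≤ θ * (rt N - rt M) + θ * rt (M * (lg M - lg N)) := by
  have e1 : rt M = ∑ i, ∑ j, ovl M N i j * (evl M i * 1) := by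
    rw [← rt_fc_mul_fc M N (fun t => t) (fun _ => 1), fc_real_one, Matrix.mul_one, fc_id hM]
  have e2 : rt N = ∑ i, ∑ j, ovl M N i j * (1 * evl N j) := by
    rw [← rt_fc_mul_fc M N (fun _ => 1) (fun t => t), fc_real_one, Matrix.one_mul, fc_id hN]
  have e3 : rt (M * lg M) = ∑ i, ∑ j, ovl M N i j * ((evl M i * Real.log (evl M i)) * 1) := by
    rw [← rt_fc_mul_fc M N (fun t => t * Real.log t) (fun _ => 1), fc_real_one, Matrix.mul_one]
    congr 1
    conv_lhs => rw [← fc_id hM]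
    unfold lg
    rw [fc_id hM]
    conv_lhs => enter [1]; rw [← fc_id hM]
    rw [fc_mul]; push_cast; rfl
  have e4 : rt (M * lg N) = ∑ i, ∑ j, ovl M N i j * (evl M i * Real.log (evl N j)) := by
    rw [← rt_fc_mul_fc M N (fun t => t) (fun t => Real.log t), fc_id hM]; rfl
  rw [pw_real, pw_real, pw_real, pw_real, rt_fc_mul_fc, rt_fc_mul_fc, Matrix.mul_sub, rt_sub, e1, e2, e3, e4]
  simp only [Finset.mul_sum, ← Finset.sum_sub_distrib, ← Finset.sum_add_distrib]
  refine Finset.sum_le_sum fun i _ => Finset.sum_le_sum fun j _ => ?_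
  have := scalar_close (Real.log (evl M i)) (Real.log (evl N j)) θ h0 h1
  rw [Real.exp_log (evl_pos _ _), Real.exp_log (evl_pos _ _)] at this
  have := mul_le_mul_of_nonneg_left this (ovl_nonneg M N i j)
  linarith

lemma scalar_ent (a b lam : ℝ) (ha : 0 < a) (hb : 0 < b) (hl : 0 < lam) :
    a * Real.log b - a * Real.log a ≤ a * Real.log lam + b / lam - a := by
  have h := Real.log_le_sub_one_of_pos (show 0 < b / (lam * a) by positivity)
  rw [Real.log_div hb.ne' (by positivity), Real.log_mul hl.ne' ha.ne'] at h
  have := mul_le_mul_of_nonneg_left h ha.le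
  have e : a * (b / (lam * a) - 1) = b / lam - a := by field_simp
  nlinarith

lemma rt_ent {M N : Matrix n n ℂ} (hM : M.PosDef) (hN : N.PosDef) (lam : ℝ) (hl : 0 < lam) :
    rt (M * lg N) - rt (M * lg M) ≤ rt M * Real.log lam + rt N / lam - rt M := by
  have e1 : rt M = ∑ i, ∑ j, ovl M N i j * (evl M i * 1) := by
    rw [← rt_fc_mul_fc M N (fun t => t) (fun _ => 1), fc_real_one, Matrix.mul_one, fc_id hM]
  have e2 : rt N = ∑ i, ∑ j, ovl M N i j * (1 * evl N j) := by
    rw [← rt_fc_mul_fc M N (fun _ => 1) (fun t => t), fc_real_one, Matrix.one_mul, fc_id hN]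
  have e3 : rt (M * lg M) = ∑ i, ∑ j, ovl M N i j * ((evl M i * Real.log (evl M i)) * 1) := by
    rw [← rt_fc_mul_fc M N (fun t => t * Real.log t) (fun _ => 1), fc_real_one, Matrix.mul_one]
    congr 1
    unfold lg
    conv_lhs => enter [1]; rw [← fc_id hM]
    rw [fc_mul]; push_cast; rfl
  have e4 : rt (M * lg N) = ∑ i, ∑ j, ovl M N i j * (evl M i * Real.log (evl N j)) := by
    rw [← rt_fc_mul_fc M N (fun t => t) (fun t => Real.log t), fc_id hM]; rfl
  rw [e1, e2, e3, e4]
  simp only [Finset.sum_mul, Finset.sum_div, ← Finset.sum_sub_distrib, ← Finset.sum_add_distrib]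
  refine Finset.sum_le_sum fun i _ => Finset.sum_le_sum fun j _ => ?_
  have := scalar_ent (evl M i) (evl N j) lam (evl_pos _ _) (evl_pos _ _) hl
  have := mul_le_mul_of_nonneg_left this (ovl_nonneg M N i j)
  calc _ = ovl M N i j * (evl M i * Real.log (evl N j) - evl M i * Real.log (evl M i)) := by ring
    _ ≤ _ := this
    _ = _ := by ring

lemma rt_nonneg {M : Matrix n n ℂ} (h : M.PosSemidef) : 0 ≤ rt M :=
  (Complex.le_def.1 h.trace_nonneg).1

lemma exists_sqrt {M : Matrix n n ℂ} (h : M.PosSemidef) : ∃ S : Matrix n n ℂ, M = Sᴴ * S := by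
  open scoped MatrixOrder in
  obtain ⟨S, hS⟩ := CStarAlgebra.nonneg_iff_eq_star_mul_self.1 h.nonneg
  exact ⟨S, hS⟩

lemma rt_mul_nonneg {M N : Matrix n n ℂ} (hM : M.PosSemidef) (hN : N.PosSemidef) : 0 ≤ rt (M * N) := by
  obtain ⟨S, rfl⟩ := exists_sqrt hM
  rw [Matrix.mul_assoc, rt_comm]
  exact rt_nonneg (hN.mul_mul_conjTranspose_same S)

section
open scoped MatrixOrder Matrix.Norms.L2Operator

lemma lg_eq {M : Matrix n n ℂ} (h : M.PosDef) : lg M = cfc Real.log M := by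
  unfold lg fc evu evl
  rw [h.isHermitian.cfc_eq]
  simp only [h, dite_true]
  rfl

lemma cfclog_mono {M N : Matrix n n ℂ} (hM : IsStrictlyPositive M) (h : M ≤ N) :
    cfc Real.log M ≤ cfc Real.log N := CFC.log_le_log h hM

lemma lg_mono {M N : Matrix n n ℂ} (hM : M.PosDef) (hN : N.PosDef) (h : (N - M).PosSemidef) :
    (lg N - lg M).PosSemidef := by
  have h1 : M ≤ N := Matrix.le_iff.2 h
  have h2 := cfclog_mono (Matrix.isStrictlyPositive_iff_posDef.2 hM) h1
  rw [lg_eq hM, lg_eq hN]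
  exact Matrix.le_iff.1 h2
end

lemma rt_lg_mono {M N : Matrix n n ℂ} (hM : M.PosDef) (hN : N.PosDef) (h : (N - M).PosSemidef) :
    rt (M * lg M) ≤ rt (M * lg N) := by
  have := rt_mul_nonneg hM.posSemidef (lg_mono hM hN h)
  rw [Matrix.mul_sub, rt_sub] at this
  linarith
end RT

section TL
variable {n : Type} [Fintype n] [DecidableEq n]

/-- entire and bounded on the strip -/
def Nice (u : ℂ → ℂ) : Prop :=
  Differentiable ℂ u ∧ ∃ C : ℝ, 0 ≤ C ∧ ∀ z : ℂ, 0 ≤ z.re → z.re ≤ 1 → ‖u z‖ ≤ C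

lemma Nice.const (c : ℂ) : Nice (fun _ => c) :=
  ⟨differentiable_const c, ‖c‖, norm_nonneg _, fun _ _ _ => le_rfl⟩

lemma Nice.mul {u v : ℂ → ℂ} (hu : Nice u) (hv : Nice v) : Nice (fun z => u z * v z) := by
  obtain ⟨du, C, hC, bu⟩ := hu
  obtain ⟨dv, D, hD, bv⟩ := hv
  refine ⟨du.mul dv, C * D, by positivity, fun z h0 h1 => ?_⟩
  rw [norm_mul]
  exact mul_le_mul (bu z h0 h1) (bv z h0 h1) (norm_nonneg _) hC

lemma Nice.add {u v : ℂ → ℂ} (hu : Nice u) (hv : Nice v) : Nice (fun z => u z + v z) := by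
  obtain ⟨du, C, hC, bu⟩ := hu
  obtain ⟨dv, D, hD, bv⟩ := hv
  refine ⟨du.add dv, C + D, by positivity, fun z h0 h1 => ?_⟩
  exact (norm_add_le _ _).trans (add_le_add (bu z h0 h1) (bv z h0 h1))

lemma Nice.sum {ι : Type} (s : Finset ι) {u : ι → ℂ → ℂ} (hu : ∀ i, Nice (u i)) :
    Nice (fun z => ∑ i ∈ s, u i z) := by
  classical
  induction s using Finset.induction_on with
  | empty => simpa using Nice.const 0
  | insert a s ha ih => simp only [Finset.sum_insert ha]; exact (hu a).add ih

lemma Nice.exp (a : ℝ) (L : ℝ) : Nice (fun z => Complex.exp (a * z * L)) := by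
  refine ⟨by fun_prop, Real.exp (|a * L|), (Real.exp_pos _).le, fun z h0 h1 => ?_⟩
  rw [Complex.norm_exp]
  refine Real.exp_le_exp.2 ?_
  have : (a * z * L).re = z.re * (a * L) := by simp [Complex.mul_re]; ring
  rw [this]
  calc z.re * (a * L) ≤ z.re * |a * L| := by gcongr; exact le_abs_self _
    _ ≤ 1 * |a * L| := by gcongr
    _ = _ := one_mul _

/-- entrywise nice -/
def MNice (T : ℂ → Matrix n n ℂ) : Prop := ∀ i j, Nice (fun z => T z i j)

lemma MNice.const (M : Matrix n n ℂ) : MNice (fun _ => M) := fun i j => Nice.const (M i j)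

lemma MNice.mul {S T : ℂ → Matrix n n ℂ} (hS : MNice S) (hT : MNice T) : MNice (fun z => S z * T z) := by
  intro i j
  simp only [Matrix.mul_apply]
  exact Nice.sum _ fun l => (hS i l).mul (hT l j)

lemma MNice.pw (M : Matrix n n ℂ) (a : ℝ) : MNice (fun z => pw M (a * z)) := by
  unfold _root_.pw fc
  refine MNice.mul (MNice.mul (MNice.const _) ?_) (MNice.const _)
  intro i j
  by_cases h : i = j
  · subst h
    simp only [diagonal_apply_eq]
    exact Nice.exp a _
  · simp only [diagonal_apply_ne _ h]
    exact Nice.const 0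

lemma three_lines {ι : Type} [Fintype ι] (u : ι → ℂ → ℂ) (hu : ∀ i, Nice (u i)) (c0 c1 : ℝ)
    (h0 : ∀ z : ℂ, z.re = 0 → ∑ i, ‖u i z‖ ^ 2 ≤ c0) (h1 : ∀ z : ℂ, z.re = 1 → ∑ i, ‖u i z‖ ^ 2 ≤ c1)
    (θ : ℝ) (ht0 : 0 ≤ θ) (ht1 : θ ≤ 1) :
    ∑ i, ‖u i θ‖ ^ 2 ≤ c0 ^ (1 - θ) * c1 ^ θ := by
  have hc0 : 0 ≤ c0 := le_trans (Finset.sum_nonneg fun i _ => by positivity) (h0 0 rfl)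
  have hc1 : 0 ≤ c1 := le_trans (Finset.sum_nonneg fun i _ => by positivity) (h1 1 rfl)
  let f : ℂ → EuclideanSpace ℂ ι := fun z => WithLp.toLp 2 (fun i => u i z)
  have hf : ∀ z, ‖f z‖ = √ (∑ i, ‖u i z‖ ^ 2) := fun z => EuclideanSpace.norm_eq _
  have hd : Differentiable ℂ f := by
    rw [differentiable_euclidean]
    exact fun i => (hu i).1
  have key := Complex.HadamardThreeLines.norm_le_interp_of_mem_verticalClosedStrip₀₁' f
    (z := (θ : ℂ)) (a := √ c0) (b := √ c1) ⟨by simpa using ht0, by simpa using ht1⟩ hd.diffContOnCl ?_ ?_ ?_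
  · rw [hf, Complex.ofReal_re] at key
    have h2 := pow_le_pow_left₀ (Real.sqrt_nonneg _) key 2
    rw [Real.sq_sqrt (Finset.sum_nonneg fun i _ => by positivity), mul_pow] at h2
    refine h2.trans (le_of_eq ?_)
    congr 1
    · rw [← Real.rpow_natCast, ← Real.rpow_mul (Real.sqrt_nonneg _), mul_comm, Real.rpow_mul (Real.sqrt_nonneg _),
        Real.rpow_natCast, Real.sq_sqrt hc0]
    · rw [← Real.rpow_natCast, ← Real.rpow_mul (Real.sqrt_nonneg _), mul_comm, Real.rpow_mul (Real.sqrt_nonneg _),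
        Real.rpow_natCast, Real.sq_sqrt hc1]
  · choose C hC hb using fun i => (hu i).2
    refine ⟨√ (∑ i, C i ^ 2), ?_⟩
    rintro _ ⟨z, hz, rfl⟩
    simp only [Function.comp]
    rw [hf]
    refine Real.sqrt_le_sqrt (Finset.sum_le_sum fun i _ => ?_)
    exact pow_le_pow_left₀ (norm_nonneg _) (hb i z hz.1 hz.2) 2
  · intro z hz
    rw [hf]; exact Real.sqrt_le_sqrt (h0 z hz)
  · intro z hz
    rw [hf]; exact Real.sqrt_le_sqrt (h1 z hz)

/-- squared Frobenius norm -/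
def fr (M : Matrix n n ℂ) : ℝ := ∑ i, ∑ j, ‖M i j‖ ^ 2

lemma fr_nonneg (M : Matrix n n ℂ) : 0 ≤ fr M := by unfold fr; positivity

lemma fr_eq (M : Matrix n n ℂ) : fr M = rt (Mᴴ * M) := by
  unfold fr rt
  rw [trace, Complex.re_sum, Finset.sum_comm]
  refine Finset.sum_congr rfl fun j _ => ?_
  rw [diag_apply, Matrix.mul_apply, Complex.re_sum]
  refine Finset.sum_congr rfl fun i _ => ?_
  rw [conjTranspose_apply, mul_comm]
  erw [Complex.mul_conj]
  rw [Complex.ofReal_re, Complex.normSq_eq_norm_sq]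

lemma three_lines_mat {J : Type} [Fintype J] (w : J → ℝ) (hw : ∀ j, 0 ≤ w j)
    (T : J → ℂ → Matrix n n ℂ) (hT : ∀ j, MNice (T j)) (c0 c1 : ℝ)
    (h0 : ∀ z : ℂ, z.re = 0 → ∑ j, w j * fr (T j z) ≤ c0)
    (h1 : ∀ z : ℂ, z.re = 1 → ∑ j, w j * fr (T j z) ≤ c1)
    (θ : ℝ) (ht0 : 0 ≤ θ) (ht1 : θ ≤ 1) :
    ∑ j, w j * fr (T j θ) ≤ c0 ^ (1 - θ) * c1 ^ θ := by
  let u : J × n × n → ℂ → ℂ := fun p z => ((√ (w p.1) : ℝ) : ℂ) * T p.1 z p.2.1 p.2.2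
  have hs : ∀ z, ∑ p, ‖u p z‖ ^ 2 = ∑ j, w j * fr (T j z) := by
    intro z
    rw [Fintype.sum_prod_type]
    refine Finset.sum_congr rfl fun j _ => ?_
    rw [Fintype.sum_prod_type, fr, Finset.mul_sum]
    refine Finset.sum_congr rfl fun i _ => ?_
    rw [Finset.mul_sum]
    refine Finset.sum_congr rfl fun l _ => ?_
    simp only [u, norm_mul, mul_pow, Complex.norm_real, Real.norm_eq_abs, sq_abs]
    rw [Real.sq_sqrt (hw j)]
  have := three_lines u (fun p => (Nice.const _).mul (hT p.1 p.2.1 p.2.2)) c0 c1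
    (fun z hz => by rw [hs]; exact h0 z hz) (fun z hz => by rw [hs]; exact h1 z hz) θ ht0 ht1
  rwa [hs] at this

lemma real_tri (a b c s : ℝ) (hs : 0 < s) :
    (a + b + c) ^ 2 ≤ (1 + s) * a ^ 2 + 2 * (1 + 1/s) * (b ^ 2 + c ^ 2) := by
  have h1 : (1 + s) * a ^ 2 + (1 + 1/s) * (b + c) ^ 2 - (a + b + c) ^ 2 = (s * a - (b + c)) ^ 2 / s := by
    field_simp; ring
  have h2 : 0 ≤ (s * a - (b + c)) ^ 2 / s := by positivity
  have h3 : 0 ≤ (1 + 1/s) * (b - c) ^ 2 := by positivity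
  nlinarith

lemma fr_tri (M N L : Matrix n n ℂ) (s : ℝ) (hs : 0 < s) :
    fr (M + N + L) ≤ (1 + s) * fr M + 2 * (1 + 1/s) * (fr N + fr L) := by
  unfold fr
  simp only [Finset.mul_sum, ← Finset.sum_add_distrib]
  refine Finset.sum_le_sum fun i _ => Finset.sum_le_sum fun j _ => ?_
  refine le_trans ?_ (real_tri ‖M i j‖ ‖N i j‖ ‖L i j‖ s hs)
  refine pow_le_pow_left₀ (norm_nonneg _) ?_ 2
  simp only [Matrix.add_apply]
  exact norm_add₃_le

/-- bilinear form -/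
def tau (K A B : Matrix n n ℂ) : ℝ := rt (Kᴴ * A * K * B)

lemma tau_fr (K S R : Matrix n n ℂ) : tau K (Sᴴ * S) (Rᴴ * R) = fr (S * K * Rᴴ) := by
  rw [fr_eq, tau]
  simp only [conjTranspose_mul, conjTranspose_conjTranspose]
  rw [← Matrix.mul_assoc, rt_comm]
  simp only [Matrix.mul_assoc]

lemma tau_conj (K A B G H : Matrix n n ℂ) : tau K (Gᴴ * A * G) (Hᴴ * B * H) = tau (G * K * Hᴴ) A B := by
  unfold tau
  rw [← Matrix.mul_assoc, rt_comm]
  simp only [Matrix.mul_assoc, conjTranspose_mul, conjTranspose_conjTranspose]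

lemma tau_swap (K A B : Matrix n n ℂ) : tau K A B = tau Kᴴ B A := by
  unfold tau
  rw [conjTranspose_conjTranspose, Matrix.mul_assoc, rt_comm]
  simp only [Matrix.mul_assoc]

lemma tau_eq (K A B : Matrix n n ℂ) : tau K A B = rt (A * (K * B * Kᴴ)) := by
  unfold tau
  rw [Matrix.mul_assoc, Matrix.mul_assoc, rt_comm]
  simp only [Matrix.mul_assoc]

lemma tau_eq' (K A B : Matrix n n ℂ) : tau K A B = rt (B * (Kᴴ * A * K)) := by
  unfold tau
  rw [rt_comm]

lemma tau_add_left (K A A' B : Matrix n n ℂ) : tau K (A + A') B = tau K A B + tau K A' B := by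
  simp only [tau_eq, Matrix.add_mul, rt_add]
lemma tau_add_right (K A B B' : Matrix n n ℂ) : tau K A (B + B') = tau K A B + tau K A B' := by
  simp only [tau_eq', Matrix.add_mul, rt_add]
lemma tau_smul_left (K A B : Matrix n n ℂ) (r : ℝ) : tau K (r • A) B = r * tau K A B := by
  simp only [tau_eq, Matrix.smul_mul, rt_smul]
lemma tau_smul_right (K A B : Matrix n n ℂ) (r : ℝ) : tau K A (r • B) = r * tau K A B := by
  simp only [tau_eq', Matrix.smul_mul, rt_smul]
lemma tau_sum_left {ι : Type} (s : Finset ι) (K B : Matrix n n ℂ) (f : ι → Matrix n n ℂ) :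
    tau K (∑ i ∈ s, f i) B = ∑ i ∈ s, tau K (f i) B := by
  simp only [tau_eq, Matrix.sum_mul, rt_sum]
lemma tau_sum_right {ι : Type} (s : Finset ι) (K A : Matrix n n ℂ) (f : ι → Matrix n n ℂ) :
    tau K A (∑ i ∈ s, f i) = ∑ i ∈ s, tau K A (f i) := by
  simp only [tau_eq', Matrix.sum_mul, rt_sum]

lemma tau_nonneg (K : Matrix n n ℂ) {A B : Matrix n n ℂ} (hA : A.PosSemidef) (hB : B.PosSemidef) :
    0 ≤ tau K A B := by
  obtain ⟨S, rfl⟩ := exists_sqrt hA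
  obtain ⟨R, rfl⟩ := exists_sqrt hB
  rw [tau_fr]; exact fr_nonneg _
end TL

section GAM
variable {n : Type} [Fintype n] [DecidableEq n]

lemma rt_ct (M : Matrix n n ℂ) : rt Mᴴ = rt M := by
  unfold rt; rw [trace_conjTranspose]; simp

/-- interpolating family -/
def Gam (P M N : Matrix n n ℂ) (z : ℂ) : Matrix n n ℂ :=
  P * pw (Pᴴ * M * P) (((-1/2 : ℝ) : ℂ) * z) * pw (Pᴴ * N * P) (((1/2 : ℝ) : ℂ) * z) * P⁻¹

lemma inv_mul_u {P : Matrix n n ℂ} (hP : IsUnit P) : P⁻¹ * P = 1 :=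
  Matrix.nonsing_inv_mul _ ((Matrix.isUnit_iff_isUnit_det P).1 hP)
lemma mul_inv_u {P : Matrix n n ℂ} (hP : IsUnit P) : P * P⁻¹ = 1 :=
  Matrix.mul_nonsing_inv _ ((Matrix.isUnit_iff_isUnit_det P).1 hP)

lemma posDef_conj {P M : Matrix n n ℂ} (hP : IsUnit P) (hM : M.PosDef) : (Pᴴ * M * P).PosDef := by
  refine hM.conjTranspose_mul_mul_same ?_
  exact Matrix.mulVec_injective_of_isUnit hP

lemma Gam_zero {P : Matrix n n ℂ} (hP : IsUnit P) (M N : Matrix n n ℂ) : Gam P M N 0 = 1 := by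
  unfold Gam
  rw [mul_zero, mul_zero, pw_zero, pw_zero, Matrix.mul_one, Matrix.mul_one, mul_inv_u hP]

lemma Gam_nice (P M N : Matrix n n ℂ) : MNice (Gam P M N) := by
  unfold Gam
  exact (((MNice.const _).mul (MNice.pw _ _)).mul (MNice.pw _ _)).mul (MNice.const _)

lemma Gam_star_nice (P M N : Matrix n n ℂ) : MNice (fun z => (Gam P M N (star z))ᴴ) := by
  have : (fun z => (Gam P M N (star z))ᴴ) = fun z => (P⁻¹)ᴴ * (pw (Pᴴ * N * P) (((1/2 : ℝ) : ℂ) * z) *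
      (pw (Pᴴ * M * P) (((-1/2 : ℝ) : ℂ) * z) * Pᴴ)) := by
    ext1 z
    unfold Gam
    simp only [conjTranspose_mul, pw_star, star_mul', star_star, Complex.star_def, Complex.conj_ofReal,
      Complex.conj_conj]
  rw [this]
  exact (MNice.const _).mul ((MNice.pw _ _).mul ((MNice.pw _ _).mul (MNice.const _)))

lemma Gam_conj {P M : Matrix n n ℂ} (hP : IsUnit P) (hM : M.PosDef) (N : Matrix n n ℂ) (z : ℂ) :
    (Gam P M N z)ᴴ * M * Gam P M N z =
      (P⁻¹)ᴴ * (pw (Pᴴ * N * P) (star (((1/2 : ℝ) : ℂ) * z)) * pw (Pᴴ * M * P) ((1 - z.re : ℝ) : ℂ) *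
        pw (Pᴴ * N * P) (((1/2 : ℝ) : ℂ) * z)) * P⁻¹ := by
  have e : pw (Pᴴ * M * P) ((1 - z.re : ℝ) : ℂ) = pw (Pᴴ * M * P) (star (((-1/2 : ℝ) : ℂ) * z)) *
      (Pᴴ * M * P) * pw (Pᴴ * M * P) (((-1/2 : ℝ) : ℂ) * z) := by
    conv_rhs => enter [1, 2]; rw [← pw_one (posDef_conj hP hM)]
    rw [← pw_add, ← pw_add]
    congr 1
    apply Complex.ext <;> simp
    ring
  rw [e]
  unfold Gam
  simp only [conjTranspose_mul, pw_star, Matrix.mul_assoc]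

lemma Gam_re_one {P M N : Matrix n n ℂ} (hP : IsUnit P) (hM : M.PosDef) (hN : N.PosDef) (z : ℂ) (hz : z.re = 1) :
    (Gam P M N z)ᴴ * M * Gam P M N z = N := by
  rw [Gam_conj hP hM, hz, sub_self, Complex.ofReal_zero, pw_zero, Matrix.mul_one, ← pw_add]
  rw [show star (((1/2 : ℝ) : ℂ) * z) + ((1/2 : ℝ) : ℂ) * z = 1 by
    apply Complex.ext <;> simp [hz]; norm_num, pw_one (posDef_conj hP hN)]
  calc _ = ((P * P⁻¹)ᴴ) * N * (P * P⁻¹) := by simp only [conjTranspose_mul, Matrix.mul_assoc]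
    _ = N := by rw [mul_inv_u hP]; simp

lemma Gam_re_zero {X : Type} [Fintype X] (μ : X → ℝ) {P N : Matrix n n ℂ} {M : X → Matrix n n ℂ} (hP : IsUnit P)
    (hM : ∀ x, (M x).PosDef) (hN : N.PosDef) (hs : ∑ x, μ x • M x = N) (z : ℂ) (hz : z.re = 0) :
    ∑ x, μ x • ((Gam P (M x) N z)ᴴ * M x * Gam P (M x) N z) = N := by
  have : ∀ x, μ x • ((Gam P (M x) N z)ᴴ * M x * Gam P (M x) N z) =
      (P⁻¹)ᴴ * (pw (Pᴴ * N * P) (star (((1/2 : ℝ) : ℂ) * z)) * (Pᴴ * (μ x • M x) * P) *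
        pw (Pᴴ * N * P) (((1/2 : ℝ) : ℂ) * z)) * P⁻¹ := by
    intro x
    rw [Gam_conj hP (hM x), hz, sub_zero, Complex.ofReal_one, pw_one (posDef_conj hP (hM x))]
    simp only [Matrix.smul_mul, Matrix.mul_smul]
  simp only [this, ← Matrix.sum_mul, ← Matrix.mul_sum, hs]
  conv_lhs => enter [1, 2, 1, 2]; rw [← pw_one (posDef_conj hP hN)]
  rw [← pw_add, ← pw_add]
  rw [show star (((1/2 : ℝ) : ℂ) * z) + 1 + ((1/2 : ℝ) : ℂ) * z = 1 by
    apply Complex.ext <;> simp [hz], pw_one (posDef_conj hP hN)]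
  calc _ = ((P * P⁻¹)ᴴ) * N * (P * P⁻¹) := by simp only [conjTranspose_mul, Matrix.mul_assoc]
    _ = N := by rw [mul_inv_u hP]; simp

lemma Gam_close {P M N : Matrix n n ℂ} (hP : IsUnit P) (hM : M.PosDef) (hN : N.PosDef) (θ : ℝ)
    (h0 : 0 ≤ θ) (h1 : θ ≤ 1) :
    rt ((1 - Gam P M N θ)ᴴ * M * (1 - Gam P M N θ) * (P * Pᴴ)) ≤
      θ * (rt (Pᴴ * N * P) - rt (Pᴴ * M * P)) +
      θ * rt ((Pᴴ * M * P) * (lg (Pᴴ * M * P) - lg (Pᴴ * N * P))) := by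
  have hR := posDef_conj hP hM
  have hR0 := posDef_conj hP hN
  refine le_trans (le_of_eq ?_) (rt_close hR hR0 θ h0 h1)
  set R := Pᴴ * M * P with hRdef
  set R0 := Pᴴ * N * P with hR0def
  set Z := pw R (((-1/2 : ℝ) : ℂ) * θ) * pw R0 (((1/2 : ℝ) : ℂ) * θ) with hZ
  have hG : Gam P M N θ * P = P * Z := by
    unfold Gam
    rw [Matrix.mul_assoc _ P⁻¹, inv_mul_u hP, Matrix.mul_one, Matrix.mul_assoc]
  have e1 : rt ((1 - Gam P M N θ)ᴴ * M * (1 - Gam P M N θ) * (P * Pᴴ)) = rt ((1 - Z)ᴴ * R * (1 - Z)) := by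
    rw [← Matrix.mul_assoc, rt_comm]
    congr 1
    have : (1 - Gam P M N θ) * P = P * (1 - Z) := by
      rw [Matrix.sub_mul, hG, Matrix.mul_sub, Matrix.one_mul, Matrix.mul_one]
    calc _ = ((1 - Gam P M N θ) * P)ᴴ * M * ((1 - Gam P M N θ) * P) := by
            simp only [conjTranspose_mul, Matrix.mul_assoc]
      _ = _ := by rw [this, hRdef]; simp only [conjTranspose_mul, Matrix.mul_assoc]
  have hRZ : R * Z = pw R ((1 - θ/2 : ℝ) : ℂ) * pw R0 ((θ/2 : ℝ) : ℂ) := by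
    rw [hZ, ← Matrix.mul_assoc]
    conv_lhs => enter [1, 1]; rw [← pw_one hR]
    rw [← pw_add]
    congr 2
    · push_cast; ring
    · push_cast; ring
  have hZR : rt (Zᴴ * R) = rt (R * Z) := by
    rw [← rt_ct, conjTranspose_mul, conjTranspose_conjTranspose, hR.isHermitian.eq]
  have hZRZ : rt (Zᴴ * R * Z) = rt (pw R ((1 - θ : ℝ) : ℂ) * pw R0 (θ : ℂ)) := by
    rw [Matrix.mul_assoc, hRZ, hZ, conjTranspose_mul, pw_star, pw_star, Matrix.mul_assoc, rt_comm]
    rw [← Matrix.mul_assoc, ← pw_add, Matrix.mul_assoc, ← pw_add]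
    congr 3
    · apply Complex.ext <;> simp; ring
    · apply Complex.ext <;> simp; ring
  rw [e1]
  simp only [conjTranspose_sub, conjTranspose_one, Matrix.sub_mul, Matrix.mul_sub, Matrix.one_mul, Matrix.mul_one, rt_sub]
  rw [hZR, hZRZ, hRZ]
  ring
end GAM

section INTERP
variable {n : Type} [Fintype n] [DecidableEq n]
variable {X Y A B : Type} [Fintype X] [Fintype Y] [Fintype A] [Fintype B]

/-- unnormalised value -/
def gval (μX : X → ℝ) (μY : Y → ℝ) (v : X → Y → A → B → ℝ) (K : Matrix n n ℂ)
    (E : X → A → Matrix n n ℂ) (F : Y → B → Matrix n n ℂ) : ℝ :=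
  ∑ x, ∑ y, ∑ a, ∑ b, μX x * μY y * v x y a b * tau K (E x a) (F y b)

/-- `ω` bounds all strategies in dimension `n` -/
def OmegaBound (n : Type) [Fintype n] [DecidableEq n]
    (μX : X → ℝ) (μY : Y → ℝ) (v : X → Y → A → B → ℝ) (ω : ℝ) : Prop :=
  ∀ (K : Matrix n n ℂ) (E : X → A → Matrix n n ℂ) (F : Y → B → Matrix n n ℂ),
    (∀ x a, (E x a).PosSemidef) → (∀ y b, (F y b).PosSemidef) →
    (∀ x, ∑ a, E x a = 1) → (∀ y, ∑ b, F y b = 1) →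
    gval μX μY v K E F ≤ ω * tau K 1 1

variable {μX : X → ℝ} {μY : Y → ℝ} {v : X → Y → A → B → ℝ} {ω : ℝ}

lemma psd_conj (G : Matrix n n ℂ) {M : Matrix n n ℂ} (h : M.PosSemidef) : (Gᴴ * M * G).PosSemidef :=
  h.conjTranspose_mul_mul_same G

lemma omega_norm (hω : OmegaBound n μX μY v ω) (K : Matrix n n ℂ) (E : X → A → Matrix n n ℂ)
    (F : Y → B → Matrix n n ℂ) (hE : ∀ x a, (E x a).PosSemidef) (hF : ∀ y b, (F y b).PosSemidef)
    {A0 B0 : Matrix n n ℂ} (hA0 : A0.PosDef) (hB0 : B0.PosDef)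
    (hEs : ∀ x, ∑ a, E x a = A0) (hFs : ∀ y, ∑ b, F y b = B0) :
    gval μX μY v K E F ≤ ω * tau K A0 B0 := by
  set S := pw A0 (1/2) with hS
  set R := pw B0 (1/2) with hR
  set Si := pw A0 (-(1/2)) with hSi
  set Ri := pw B0 (-(1/2)) with hRi
  have Sh : Sᴴ = S := pw_half_star A0
  have Rh : Rᴴ = R := pw_half_star B0
  have Sih : Siᴴ = Si := by rw [hSi, pw_star]; congr 1; simp
  have Rih : Riᴴ = Ri := by rw [hRi, pw_star]; congr 1; simp
  have SSi : S * Si = 1 := by rw [hS, hSi, ← pw_add, add_neg_cancel, pw_zero]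
  have SiS : Si * S = 1 := by rw [hS, hSi, ← pw_add, neg_add_cancel, pw_zero]
  have RRi : R * Ri = 1 := by rw [hR, hRi, ← pw_add, add_neg_cancel, pw_zero]
  have RiR : Ri * R = 1 := by rw [hR, hRi, ← pw_add, neg_add_cancel, pw_zero]
  have SS : S * S = A0 := pw_half_mul hA0
  have RR : R * R = B0 := pw_half_mul hB0
  have key := hω (S * K * Rᴴ) (fun x a => Siᴴ * E x a * Si) (fun y b => Riᴴ * F y b * Ri)
    (fun x a => psd_conj _ (hE x a)) (fun y b => psd_conj _ (hF y b))
    (fun x => by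
      rw [← Matrix.sum_mul, ← Matrix.mul_sum, hEs, ← SS, Sih]
      rw [show Si * (S * S) * Si = (Si * S) * (S * Si) by simp only [Matrix.mul_assoc], SSi, SiS, Matrix.one_mul])
    (fun y => by
      rw [← Matrix.sum_mul, ← Matrix.mul_sum, hFs, ← RR, Rih]
      rw [show Ri * (R * R) * Ri = (Ri * R) * (R * Ri) by simp only [Matrix.mul_assoc], RRi, RiR, Matrix.one_mul])
  have e1 : tau (S * K * Rᴴ) 1 1 = tau K A0 B0 := by
    rw [← tau_conj, Matrix.mul_one, Matrix.mul_one, Sh, Rh, SS, RR]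
  have e2 : gval μX μY v (S * K * Rᴴ) (fun x a => Siᴴ * E x a * Si) (fun y b => Riᴴ * F y b * Ri) =
      gval μX μY v K E F := by
    unfold gval
    simp only [← tau_conj]
    have h1 : ∀ M, Sᴴ * (Siᴴ * M * Si) * S = M := by
      intro M
      rw [Sh, Sih, show S * (Si * M * Si) * S = (S * Si) * M * (Si * S) by simp only [Matrix.mul_assoc], SSi, SiS]; simp
    have h2 : ∀ M, Rᴴ * (Riᴴ * M * Ri) * R = M := by
      intro M
      rw [Rh, Rih, show R * (Ri * M * Ri) * R = (R * Ri) * M * (Ri * R) by simp only [Matrix.mul_assoc], RRi, RiR]; simp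
    simp only [h1, h2]
  rwa [e1, e2] at key

lemma gval_drop (hX : ∀ x, 0 ≤ μX x) (hY : ∀ y, 0 ≤ μY y)
    (hv1 : ∀ x y a b, v x y a b ≤ 1) (K : Matrix n n ℂ) (E : X → A → Matrix n n ℂ)
    (F : Y → B → Matrix n n ℂ) (hE : ∀ x a, (E x a).PosSemidef) (hF : ∀ y b, (F y b).PosSemidef) :
    gval μX μY v K E F ≤ tau K (∑ x, μX x • ∑ a, E x a) (∑ y, μY y • ∑ b, F y b) := by
  unfold gval
  simp only [tau_sum_left, tau_sum_right, tau_smul_left, tau_smul_right, Finset.mul_sum]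
  rw [Finset.sum_comm]
  refine Finset.sum_le_sum fun y _ => ?_
  conv_rhs => rw [Finset.sum_comm]
  refine Finset.sum_le_sum fun x _ => ?_
  rw [Finset.sum_comm]
  refine Finset.sum_le_sum fun b _ => Finset.sum_le_sum fun a _ => ?_
  have := tau_nonneg K (hE x a) (hF y b)
  have h2 : μX x * μY y * v x y a b ≤ μX x * μY y * 1 :=
    mul_le_mul_of_nonneg_left (hv1 x y a b) (mul_nonneg (hX x) (hY y))
  calc _ ≤ μX x * μY y * 1 * tau K (E x a) (F y b) := mul_le_mul_of_nonneg_right h2 this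
    _ = _ := by ring

lemma rpow_split {t θ : ℝ} (ht : 0 ≤ t) (hω : 0 ≤ ω) (h0 : 0 ≤ θ) (h1 : θ ≤ 1) :
    t ^ (1 - θ) * (ω * t) ^ θ = ω ^ θ * t := by
  rw [Real.mul_rpow hω ht]
  have : t ^ (1 - θ) * t ^ θ = t := by
    rw [← Real.rpow_add_of_nonneg ht (by linarith) h0]; simp
  calc _ = ω ^ θ * (t ^ (1 - θ) * t ^ θ) := by ring
    _ = _ := by rw [this]

lemma gam_contract (hY : ∀ y, 0 ≤ μY y) {By : Y → Matrix n n ℂ} {Bb P Q : Matrix n n ℂ}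
    (hBy : ∀ y, (By y).PosDef) (hBb : Bb.PosDef) (hs : ∑ y, μY y • By y = Bb) (hs1 : ∑ y, μY y = 1)
    (hP : IsUnit P)
    (hQ : Q.PosSemidef) (θ : ℝ) (h0 : 0 ≤ θ) (h1 : θ ≤ 1) :
    rt (Q * ∑ y, μY y • ((Gam P (By y) Bb θ)ᴴ * By y * Gam P (By y) Bb θ)) ≤ rt (Q * Bb) := by
  obtain ⟨S, rfl⟩ := exists_sqrt hQ
  choose R hR using fun y => exists_sqrt (hBy y).posSemidef
  have hfr : ∀ z, ∑ y, μY y * fr (R y * Gam P (By y) Bb z * Sᴴ) =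
      rt ((Sᴴ * S) * ∑ y, μY y • ((Gam P (By y) Bb z)ᴴ * By y * Gam P (By y) Bb z)) := by
    intro z
    simp only [← tau_fr, ← hR, tau_eq', Matrix.mul_sum, rt_sum, Matrix.mul_smul, rt_smul]
  rw [← hfr]
  refine (three_lines_mat μY hY (fun y z => R y * Gam P (By y) Bb z * Sᴴ)
    (fun y => ((MNice.const _).mul (Gam_nice _ _ _)).mul (MNice.const _)) (rt (Sᴴ * S * Bb)) (rt (Sᴴ * S * Bb))
    ?_ ?_ θ h0 h1).trans ?_
  · intro z hz
    rw [hfr, Gam_re_zero μY hP hBy hBb hs z hz]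
  · intro z hz
    rw [hfr]
    simp only [Gam_re_one hP (hBy _) hBb z hz, ← Finset.sum_smul, hs1, one_smul, le_refl]
  · have := rpow_split (ω := 1) (rt_mul_nonneg hQ hBb.posSemidef) zero_le_one h0 h1
    rw [one_mul, Real.one_rpow, one_mul] at this
    exact this.le

lemma gval_eq_sum (K : Matrix n n ℂ) (E : X → A → Matrix n n ℂ) (F : Y → B → Matrix n n ℂ) :
    gval μX μY v K E F = ∑ p : X × Y × A × B, μX p.1 * μY p.2.1 * v p.1 p.2.1 p.2.2.1 p.2.2.2 *
      tau K (E p.1 p.2.2.1) (F p.2.1 p.2.2.2) := by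
  simp only [gval, Fintype.sum_prod_type]

lemma interp (hω : OmegaBound n μX μY v ω) (hω0 : 0 ≤ ω)
    (hX : ∀ x, 0 ≤ μX x) (hY : ∀ y, 0 ≤ μY y) (_hX1 : ∑ x, μX x = 1) (hY1 : ∑ y, μY y = 1)
    (hv0 : ∀ x y a b, 0 ≤ v x y a b) (hv1 : ∀ x y a b, v x y a b ≤ 1)
    (K : Matrix n n ℂ) (E : X → A → Matrix n n ℂ)
    (F : Y → B → Matrix n n ℂ) (hE : ∀ x a, (E x a).PosSemidef) (hF : ∀ y b, (F y b).PosSemidef)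
    {Ax : X → Matrix n n ℂ} {By : Y → Matrix n n ℂ} {Ab Bb PA PB : Matrix n n ℂ}
    (hAx : ∀ x, (Ax x).PosDef) (hBy : ∀ y, (By y).PosDef) (hAb : Ab.PosDef) (hBb : Bb.PosDef)
    (hEs : ∀ x, ∑ a, E x a = Ax x) (hFs : ∀ y, ∑ b, F y b = By y)
    (hAs : ∑ x, μX x • Ax x = Ab) (hBs : ∑ y, μY y • By y = Bb)
    (hPA : IsUnit PA) (hPB : IsUnit PB) (θ s : ℝ) (h0 : 0 ≤ θ) (h1 : θ ≤ 1) (hs : 0 < s) :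
    gval μX μY v K E F ≤ (1 + s) * (ω ^ θ * tau K Ab Bb) + 2 * (1 + 1/s) *
      (tau K Ab (∑ y, μY y • ((1 - Gam PB (By y) Bb θ)ᴴ * By y * (1 - Gam PB (By y) Bb θ))) +
       tau K (∑ x, μX x • ((1 - Gam PA (Ax x) Ab θ)ᴴ * Ax x * (1 - Gam PA (Ax x) Ab θ))) Bb) := by
  choose S hS using fun x a => exists_sqrt (hE x a)
  choose R hR using fun y b => exists_sqrt (hF y b)
  set Γ : X → ℂ → Matrix n n ℂ := fun x z => Gam PA (Ax x) Ab z with hΓ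
  set Δ : Y → ℂ → Matrix n n ℂ := fun y z => Gam PB (By y) Bb z with hΔ
  have hfr : ∀ x y a b (G H : Matrix n n ℂ), fr (S x a * G * K * Hᴴ * (R y b)ᴴ) =
      tau K (Gᴴ * E x a * G) (Hᴴ * F y b * H) := by
    intro x y a b G H
    rw [tau_conj, hS, hR, tau_fr]
    simp only [Matrix.mul_assoc]
  have tt : 0 ≤ tau K Ab Bb := tau_nonneg K hAb.posSemidef hBb.posSemidef
  -- main term
  have hmain : gval μX μY v K (fun x a => (Γ x θ)ᴴ * E x a * Γ x θ) (fun y b => (Δ y θ)ᴴ * F y b * Δ y θ)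
      ≤ ω ^ θ * tau K Ab Bb := by
    rw [← rpow_split tt hω0 h0 h1]
    have hT : ∀ z, ∑ p : X × Y × A × B, μX p.1 * μY p.2.1 * v p.1 p.2.1 p.2.2.1 p.2.2.2 *
        fr (S p.1 p.2.2.1 * Γ p.1 z * K * (Δ p.2.1 (star z))ᴴ * (R p.2.1 p.2.2.2)ᴴ) =
        gval μX μY v K (fun x a => (Γ x z)ᴴ * E x a * Γ x z)
          (fun y b => (Δ y (star z))ᴴ * F y b * Δ y (star z)) := by
      intro z
      rw [gval_eq_sum]
      simp only [hfr]
    have := three_lines_mat (fun p : X × Y × A × B => μX p.1 * μY p.2.1 * v p.1 p.2.1 p.2.2.1 p.2.2.2)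
      (fun p => mul_nonneg (mul_nonneg (hX _) (hY _)) (hv0 _ _ _ _))
      (fun p z => S p.1 p.2.2.1 * Γ p.1 z * K * (Δ p.2.1 (star z))ᴴ * (R p.2.1 p.2.2.2)ᴴ)
      (fun p => ((((MNice.const _).mul (Gam_nice _ _ _)).mul (MNice.const _)).mul
        (Gam_star_nice _ _ _)).mul (MNice.const _)) (tau K Ab Bb) (ω * tau K Ab Bb) ?_ ?_ θ h0 h1
    · rw [hT] at this
      simpa using this
    · intro z hz
      rw [hT]
      refine (gval_drop hX hY hv1 K _ _ (fun x a => psd_conj _ (hE x a)) (fun y b => psd_conj _ (hF y b))).trans ?_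
      simp only [← Matrix.mul_sum, ← Matrix.sum_mul, hEs, hFs]
      rw [Gam_re_zero μX hPA hAx hAb hAs z hz, Gam_re_zero μY hPB hBy hBb hBs (star z) (by simpa using hz)]
    · intro z hz
      rw [hT]
      refine omega_norm hω K _ _ (fun x a => psd_conj _ (hE x a)) (fun y b => psd_conj _ (hF y b)) hAb hBb ?_ ?_
      · intro x
        rw [← Matrix.sum_mul, ← Matrix.mul_sum, hEs]
        exact Gam_re_one hPA (hAx x) hAb z hz
      · intro y
        rw [← Matrix.sum_mul, ← Matrix.mul_sum, hFs]
        exact Gam_re_one hPB (hBy y) hBb _ (by simpa using hz)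
  have h2 : gval μX μY v K E (fun y b => (1 - Δ y θ)ᴴ * F y b * (1 - Δ y θ)) ≤
      tau K Ab (∑ y, μY y • ((1 - Δ y θ)ᴴ * By y * (1 - Δ y θ))) := by
    refine (gval_drop hX hY hv1 K _ _ hE (fun y b => psd_conj _ (hF y b))).trans ?_
    simp only [← Matrix.mul_sum, ← Matrix.sum_mul, hEs, hFs, hAs, le_refl]
  have h3 : gval μX μY v K (fun x a => (1 - Γ x θ)ᴴ * E x a * (1 - Γ x θ)) (fun y b => (Δ y θ)ᴴ * F y b * Δ y θ) ≤
      tau K (∑ x, μX x • ((1 - Γ x θ)ᴴ * Ax x * (1 - Γ x θ))) Bb := by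
    refine (gval_drop hX hY hv1 K _ _ (fun x a => psd_conj _ (hE x a)) (fun y b => psd_conj _ (hF y b))).trans ?_
    simp only [← Matrix.mul_sum, ← Matrix.sum_mul, hEs, hFs]
    have hQ : (Kᴴ * (∑ x, μX x • ((1 - Γ x θ)ᴴ * Ax x * (1 - Γ x θ))) * K).PosSemidef := by
      refine psd_conj _ (Matrix.posSemidef_sum _ fun x _ => ?_)
      exact (psd_conj _ (hAx x).posSemidef).smul (hX x)
    exact gam_contract hY hBy hBb hBs hY1 hPB hQ θ h0 h1
  have hpt : gval μX μY v K E F ≤ (1 + s) *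
      gval μX μY v K (fun x a => (Γ x θ)ᴴ * E x a * Γ x θ) (fun y b => (Δ y θ)ᴴ * F y b * Δ y θ) +
      2 * (1 + 1/s) * (gval μX μY v K E (fun y b => (1 - Δ y θ)ᴴ * F y b * (1 - Δ y θ)) +
       gval μX μY v K (fun x a => (1 - Γ x θ)ᴴ * E x a * (1 - Γ x θ)) (fun y b => (Δ y θ)ᴴ * F y b * Δ y θ)) := by
    simp only [gval_eq_sum, Finset.mul_sum, ← Finset.sum_add_distrib]
    refine Finset.sum_le_sum fun p _ => ?_
    obtain ⟨x, y, a, b⟩ := p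
    simp only
    have w0 : 0 ≤ μX x * μY y * v x y a b := mul_nonneg (mul_nonneg (hX _) (hY _)) (hv0 _ _ _ _)
    have := fr_tri (S x a * Γ x θ * K * (Δ y θ)ᴴ * (R y b)ᴴ) (S x a * 1 * K * (1 - Δ y θ)ᴴ * (R y b)ᴴ)
      (S x a * (1 - Γ x θ) * K * (Δ y θ)ᴴ * (R y b)ᴴ) s hs
    rw [hfr, hfr, hfr] at this
    have e : S x a * Γ x θ * K * (Δ y θ)ᴴ * (R y b)ᴴ + S x a * 1 * K * (1 - Δ y θ)ᴴ * (R y b)ᴴ +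
      S x a * (1 - Γ x θ) * K * (Δ y θ)ᴴ * (R y b)ᴴ = S x a * 1 * K * (1 : Matrix n n ℂ)ᴴ * (R y b)ᴴ := by
      simp only [conjTranspose_sub, conjTranspose_one]
      noncomm_ring
    rw [e, hfr] at this
    simp only [conjTranspose_one, Matrix.one_mul, Matrix.mul_one] at this
    have := mul_le_mul_of_nonneg_left this w0
    linarith
  refine hpt.trans ?_
  gcongr
end INTERP

section EXP
variable {X : Type} [Fintype X] {k : ℕ}
variable {V : Type} [AddCommGroup V] [Module ℝ V]

/-- product weight -/
def pm (μ : X → ℝ) (x : Fin k → X) : ℝ := ∏ i, μ (x i)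

/-- expectation -/
def Ex (μ : X → ℝ) (f : (Fin k → X) → V) : V := ∑ x, pm μ x • f x

/-- conditional expectation given coordinates in `S` -/
def cE (μ : X → ℝ) (S : Finset (Fin k)) (f : (Fin k → X) → V) (x : Fin k → X) : V :=
  Ex μ (fun x' => f (S.piecewise x x'))

/-- depends only on coordinates in `S` -/
def DepOn {W : Type} (S : Finset (Fin k)) (f : (Fin k → X) → W) : Prop :=
  ∀ x x' : Fin k → X, (∀ i ∈ S, x i = x' i) → f x = f x'

variable {μ : X → ℝ}

lemma pm_nonneg (hμ : ∀ x, 0 ≤ μ x) (x : Fin k → X) : 0 ≤ pm μ x := Finset.prod_nonneg fun _ _ => hμ _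

lemma sum_pm (h1 : ∑ x, μ x = 1) : ∑ x : Fin k → X, pm μ x = 1 := by
  classical
  have := Finset.prod_univ_sum (fun _ : Fin k => (Finset.univ : Finset X)) (fun _ x => μ x)
  rw [Fintype.piFinset_univ] at this
  unfold pm
  rw [← this]; simp [h1]

lemma Ex_const (h1 : ∑ x, μ x = 1) (c : V) : Ex (k := k) μ (fun _ => c) = c := by
  unfold Ex
  rw [← Finset.sum_smul, sum_pm h1, one_smul]

lemma Ex_add (f g : (Fin k → X) → V) : Ex μ (fun x => f x + g x) = Ex μ f + Ex μ g := by
  simp [Ex, smul_add, Finset.sum_add_distrib]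

lemma Ex_sub (f g : (Fin k → X) → V) : Ex μ (fun x => f x - g x) = Ex μ f - Ex μ g := by
  simp [Ex, smul_sub, Finset.sum_sub_distrib]

lemma Ex_sum {ι : Type} (s : Finset ι) (f : ι → (Fin k → X) → V) :
    Ex μ (fun x => ∑ i ∈ s, f i x) = ∑ i ∈ s, Ex μ (f i) := by
  simp only [Ex, Finset.smul_sum]
  rw [Finset.sum_comm]

lemma Ex_smul (c : ℝ) (f : (Fin k → X) → V) : Ex μ (fun x => c • f x) = c • Ex μ f := by
  simp only [Ex, Finset.smul_sum, smul_comm c]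

lemma Ex_mul (c : ℝ) (f : (Fin k → X) → ℝ) : Ex μ (fun x => c * f x) = c * Ex μ f := Ex_smul c f

lemma Ex_map {W : Type} [AddCommGroup W] [Module ℝ W] {L : V → W} (hL : IsLinearMap ℝ L) (f : (Fin k → X) → V) :
    L (Ex μ f) = Ex μ (fun x => L (f x)) := by
  have := map_sum (hL.mk' L) (fun x => pm μ x • f x) Finset.univ
  simp only [map_smul, IsLinearMap.mk'_apply] at this
  exact this

lemma Ex_le (hμ : ∀ x, 0 ≤ μ x) {f g : (Fin k → X) → ℝ} (h : ∀ x, f x ≤ g x) : Ex μ f ≤ Ex μ g :=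
  Finset.sum_le_sum fun x _ => mul_le_mul_of_nonneg_left (h x) (pm_nonneg hμ x)

lemma Ex_nonneg (hμ : ∀ x, 0 ≤ μ x) {f : (Fin k → X) → ℝ} (h : ∀ x, 0 ≤ f x) : 0 ≤ Ex μ f :=
  Finset.sum_nonneg fun x _ => mul_nonneg (pm_nonneg hμ x) (h x)

lemma Ex_comm {Y : Type} [Fintype Y] {ν : Y → ℝ} (f : (Fin k → X) → (Fin k → Y) → V) :
    Ex μ (fun x => Ex ν (fun y => f x y)) = Ex ν (fun y => Ex μ (fun x => f x y)) := by
  simp only [Ex, Finset.smul_sum]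
  rw [Finset.sum_comm]
  simp only [smul_comm (pm μ _)]

lemma pm_swap (S : Finset (Fin k)) (x x' : Fin k → X) :
    pm μ (S.piecewise x x') * pm μ (S.piecewise x' x) = pm μ x * pm μ x' := by
  classical
  unfold pm
  rw [← Finset.prod_mul_distrib, ← Finset.prod_mul_distrib]
  refine Finset.prod_congr rfl fun i _ => ?_
  by_cases h : i ∈ S
  · simp [h]
  · simp [h, mul_comm]

lemma Ex_swap (S : Finset (Fin k)) (F : (Fin k → X) → (Fin k → X) → V) :
    Ex μ (fun x => Ex μ (fun x' => F (S.piecewise x x') (S.piecewise x' x))) =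
      Ex μ (fun x => Ex μ (fun x' => F x x')) := by
  classical
  simp only [Ex, Finset.smul_sum, smul_smul]
  rw [← Fintype.sum_prod_type', ← Fintype.sum_prod_type']
  let e : (Fin k → X) × (Fin k → X) → (Fin k → X) × (Fin k → X) :=
    fun p => (S.piecewise p.1 p.2, S.piecewise p.2 p.1)
  have he : Function.Involutive e := by
    intro p
    refine Prod.ext ?_ ?_
    · funext i; by_cases h : i ∈ S <;> simp [e, h]
    · funext i; by_cases h : i ∈ S <;> simp [e, h]
  refine Fintype.sum_equiv he.toPerm _ _ fun p => ?_
  simp only [Function.Involutive.coe_toPerm, e]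
  rw [pm_swap]

lemma cE_dep (S : Finset (Fin k)) (f : (Fin k → X) → V) : DepOn S (cE μ S f) := by
  intro x x' h
  unfold cE
  congr 1; funext y; congr 1
  exact Finset.piecewise_congr _ h fun _ _ => rfl

lemma DepOn.mono {W : Type} {S T : Finset (Fin k)} {f : (Fin k → X) → W} (h : DepOn S f) (hST : S ⊆ T) :
    DepOn T f := fun x x' hx => h x x' fun i hi => hx i (hST hi)

lemma tower (h1 : ∑ x, μ x = 1) (S : Finset (Fin k)) (l : (Fin k → X) → V → ℝ) (hl : ∀ x, IsLinearMap ℝ (l x))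
    (hd : DepOn S l) (f : (Fin k → X) → V) :
    Ex μ (fun x => l x (cE μ S f x)) = Ex μ (fun x => l x (f x)) := by
  have e1 : ∀ x, l x (cE μ S f x) = Ex μ (fun x' => l (S.piecewise x x') (f (S.piecewise x x'))) := by
    intro x
    unfold cE
    rw [Ex_map (hl x)]
    congr 1; funext x'
    rw [hd x (S.piecewise x x') fun i hi => by simp [hi]]
  simp only [e1]
  rw [Ex_swap S (fun u _ => l u (f u))]
  simp only [Ex_const h1]

lemma cE_univ (h1 : ∑ x, μ x = 1) (f : (Fin k → X) → V) : cE μ Finset.univ f = f := by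
  funext x
  unfold cE
  simp [Finset.piecewise_univ, Ex_const h1]

lemma cE_sum {ι : Type} (s : Finset ι) (S : Finset (Fin k)) (f : ι → (Fin k → X) → V) (x : Fin k → X) :
    cE μ S (fun x => ∑ i ∈ s, f i x) x = ∑ i ∈ s, cE μ S (f i) x := Ex_sum s _

lemma Ex_marg (h1 : ∑ x, μ x = 1) (i : Fin k) (g : X → V) : Ex μ (fun x : Fin k → X => g (x i)) = ∑ x0, μ x0 • g x0 := by
  classical
  have key : ∀ x0, ∑ x : Fin k → X, (pm μ x * if x i = x0 then 1 else 0) = μ x0 := by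
    intro x0
    have := Finset.prod_univ_sum (fun _ : Fin k => (Finset.univ : Finset X))
      (fun j x => μ x * if j = i then (if x = x0 then (1:ℝ) else 0) else 1)
    rw [Fintype.piFinset_univ] at this
    have e : ∀ x : Fin k → X, pm μ x * (if x i = x0 then 1 else 0) =
        ∏ j, (μ (x j) * if j = i then (if x j = x0 then (1:ℝ) else 0) else 1) := by
      intro x
      rw [Finset.prod_mul_distrib, Finset.prod_ite_eq' Finset.univ i]
      simp [pm]
    simp only [e]
    rw [← this, Finset.prod_eq_single i]
    · simp
    · intro j _ hj; simp [hj, h1]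
    · simp
  have e2 : ∀ x : Fin k → X, pm μ x • g (x i) = ∑ x0, (pm μ x * if x i = x0 then 1 else 0) • g x0 := by
    intro x
    simp
  unfold Ex
  simp only [e2]
  rw [Finset.sum_comm]
  simp only [← Finset.sum_smul, key]

lemma Ex_update (h1 : ∑ x, μ x = 1) (i : Fin k) (f : (Fin k → X) → V) :
    Ex μ f = Ex μ (fun x => ∑ x0, μ x0 • f (Function.update x i x0)) := by
  have e : ∀ x : Fin k → X, ∑ x0, μ x0 • f (Function.update x i x0) =
      Ex μ (fun x' => f ((Finset.univ.erase i).piecewise x x')) := by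
    intro x
    rw [← Ex_marg h1 i (fun x0 => f (Function.update x i x0))]
    congr 1; funext x'; congr 1; funext j
    by_cases h : j = i
    · subst h; simp
    · simp [h]
  simp only [e]
  rw [Ex_swap (Finset.univ.erase i) (fun u _ => f u)]
  simp only [Ex_const h1]

lemma cE_insert (h1 : ∑ x, μ x = 1) (D : Finset (Fin k)) (i : Fin k) (hi : i ∉ D) (f : (Fin k → X) → V) (x : Fin k → X) :
    cE μ D f x = ∑ x0, μ x0 • cE μ (insert i D) f (Function.update x i x0) := by
  unfold cE
  rw [Ex_update h1 i, Ex_sum]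
  refine Finset.sum_congr rfl fun x0 _ => ?_
  rw [Ex_smul]
  congr 2; funext x'; congr 1; funext j
  by_cases h : j = i
  · subst h; simp [hi]
  · by_cases hj : j ∈ D <;> simp [h, hj]

variable {n : Type} [Fintype n] [DecidableEq n]

lemma posDef_wsum {ι : Type} [Fintype ι] (w : ι → ℝ) (hw : ∀ i, 0 ≤ w i) (hw1 : ∑ i, w i = 1)
    (M : ι → Matrix n n ℂ) (hM : ∀ i, (M i).PosDef) : (∑ i, w i • M i).PosDef := by
  classical
  obtain ⟨i, hi⟩ : ∃ i, 0 < w i := by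
    by_contra! h
    have : ∑ i, w i ≤ 0 := Finset.sum_nonpos fun i _ => h i
    linarith
  rw [← Finset.add_sum_erase _ _ (Finset.mem_univ i)]
  refine Matrix.PosDef.add_posSemidef ((hM i).smul hi) (Matrix.posSemidef_sum _ fun j _ => ?_)
  exact (hM j).posSemidef.smul (hw j)

lemma psd_wsum {ι : Type} [Fintype ι] (w : ι → ℝ) (hw : ∀ i, 0 ≤ w i)
    (M : ι → Matrix n n ℂ) (hM : ∀ i, (M i).PosSemidef) : (∑ i, w i • M i).PosSemidef :=
  Matrix.posSemidef_sum _ fun j _ => (hM j).smul (hw j)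

lemma cE_posDef (hμ : ∀ x, 0 ≤ μ x) (h1 : ∑ x, μ x = 1) (S : Finset (Fin k)) (f : (Fin k → X) → Matrix n n ℂ)
    (hf : ∀ x, (f x).PosDef) (x : Fin k → X) : (cE μ S f x).PosDef :=
  posDef_wsum _ (pm_nonneg hμ) (sum_pm h1) _ fun _ => hf _

lemma cE_psd (hμ : ∀ x, 0 ≤ μ x) (S : Finset (Fin k)) (f : (Fin k → X) → Matrix n n ℂ)
    (hf : ∀ x, (f x).PosSemidef) (x : Fin k → X) : (cE μ S f x).PosSemidef :=
  psd_wsum _ (pm_nonneg hμ) _ fun _ => hf _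
end EXP

section ENT
variable {X : Type} [Fintype X] {k : ℕ} {μ : X → ℝ}
variable {n : Type} [Fintype n] [DecidableEq n]

/-- the filtration of coordinate sets -/
def Dset (C : Finset (Fin k)) (j : ℕ) : Finset (Fin k) := C ∪ Finset.univ.filter (fun i => i.val < j)

lemma Dset_zero (C : Finset (Fin k)) : Dset C 0 = C := by simp [Dset]
lemma Dset_k (C : Finset (Fin k)) : Dset C k = Finset.univ := by
  ext i; simp [Dset]
lemma Dset_succ (C : Finset (Fin k)) (i : Fin k) : Dset C (i.val + 1) = insert i (Dset C i.val) := by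
  ext j
  simp only [Dset, Finset.mem_union, Finset.mem_filter, Finset.mem_univ, true_and, Finset.mem_insert, Fin.ext_iff]
  constructor
  · rintro (h | h)
    · tauto
    · by_cases h2 : j.val = i.val
      · tauto
      · right; right; omega
  · rintro (h | h | h)
    · right; omega
    · tauto
    · right; omega
lemma Dset_mono (C : Finset (Fin k)) (j : ℕ) : Dset C j ⊆ Dset C (j + 1) := by
  intro i
  simp only [Dset, Finset.mem_union, Finset.mem_filter, Finset.mem_univ, true_and]
  rintro (h | h)
  · tauto
  · right; omega
lemma C_sub_Dset (C : Finset (Fin k)) (j : ℕ) : C ⊆ Dset C j := Finset.subset_union_left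
lemma not_mem_Dset {C : Finset (Fin k)} {i : Fin k} (h : i ∉ C) : i ∉ Dset C i.val := by
  simp [Dset, h]
lemma Dset_succ_of_mem {C : Finset (Fin k)} {i : Fin k} (h : i ∈ C) : Dset C (i.val + 1) = Dset C i.val := by
  rw [Dset_succ, Finset.insert_eq_of_mem (C_sub_Dset C _ h)]

/-- conditional operator -/
def rho (μ : X → ℝ) (C : Finset (Fin k)) (P : Matrix n n ℂ) (f : (Fin k → X) → Matrix n n ℂ) (j : ℕ)
    (x : Fin k → X) : Matrix n n ℂ := Pᴴ * cE μ (Dset C j) f x * P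

/-- relative entropy increment -/
def relent (μ : X → ℝ) (C : Finset (Fin k)) (P : Matrix n n ℂ) (f : (Fin k → X) → Matrix n n ℂ) (j : ℕ)
    (x : Fin k → X) : ℝ :=
  rt (rho μ C P f (j + 1) x * (lg (rho μ C P f (j + 1) x) - lg (rho μ C P f j x)))

lemma relent_of_mem {C : Finset (Fin k)} {i : Fin k} (h : i ∈ C) (P : Matrix n n ℂ)
    (f : (Fin k → X) → Matrix n n ℂ) (x : Fin k → X) : relent μ C P f i.val x = 0 := by
  unfold relent rho
  rw [Dset_succ_of_mem h, sub_self, Matrix.mul_zero]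
  simp [rt]

lemma lin_aux (w : ℝ) (P L : Matrix n n ℂ) : IsLinearMap ℝ (fun M => w * rt (Pᴴ * M * P * L)) := by
  constructor
  · intro M N
    simp only [Matrix.add_mul, rt_add, mul_add]
  · intro c M
    simp only [Matrix.mul_smul, Matrix.smul_mul, rt_smul, smul_eq_mul]
    ring

lemma relent_sum (hμ : ∀ x, 0 ≤ μ x) (h1 : ∑ x, μ x = 1) (C : Finset (Fin k)) {P : Matrix n n ℂ} (hP : IsUnit P)
    (f : (Fin k → X) → Matrix n n ℂ) (hf : ∀ x, (f x).PosDef) (hf1 : ∀ x, (1 - f x).PosSemidef)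
    (w : (Fin k → X) → ℝ) (hw : ∀ x, 0 ≤ w x) (hwd : DepOn C w) (lam : ℝ) (hlam : 0 < lam) :
    ∑ i : Fin k, Ex μ (fun x => w x * relent μ C P f i.val x) ≤
      Ex μ (fun x => w x * (rt (Pᴴ * cE μ C f x * P) * Real.log lam + rt (Pᴴ * P) / lam - rt (Pᴴ * cE μ C f x * P))) := by
  set S : ℕ → ℝ := fun j => Ex μ (fun x => w x * rt (rho μ C P f j x * lg (rho μ C P f j x))) with hS
  have hstep : ∀ j, Ex μ (fun x => w x * relent μ C P f j x) = S (j + 1) - S j := by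
    intro j
    have ha : ∀ T, Dset C j ⊆ T → Ex μ (fun x => w x * rt (Pᴴ * cE μ T f x * P * lg (rho μ C P f j x))) =
        Ex μ (fun x => w x * rt (Pᴴ * f x * P * lg (rho μ C P f j x))) := by
      intro T hT
      refine tower h1 T (fun x M => w x * rt (Pᴴ * M * P * lg (rho μ C P f j x))) (fun x => lin_aux _ _ _) ?_ f
      intro x x' hx
      have e1 : w x = w x' := hwd x x' fun i hi => hx i (hT (C_sub_Dset C j hi))
      have e2 : rho μ C P f j x = rho μ C P f j x' := by
        unfold rho
        rw [cE_dep (Dset C j) f x x' fun i hi => hx i (hT hi)]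
      beta_reduce
      rw [e1, e2]
    have h2 := ha (Dset C (j + 1)) (Dset_mono C j)
    have h3 := ha (Dset C j) (Finset.Subset.refl _)
    have hr : ∀ x, w x * relent μ C P f j x = w x * rt (rho μ C P f (j + 1) x * lg (rho μ C P f (j + 1) x)) -
        w x * rt (rho μ C P f (j + 1) x * lg (rho μ C P f j x)) := by
      intro x
      rw [relent, Matrix.mul_sub, rt_sub, mul_sub]
    have h4 : Ex μ (fun x => w x * rt (rho μ C P f (j + 1) x * lg (rho μ C P f j x))) = S j := h2.trans h3.symm
    simp only [hr]
    rw [Ex_sub, h4]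
  simp only [hstep]
  rw [Fin.sum_univ_eq_sum_range (fun j => S (j + 1) - S j) k, Finset.sum_range_sub]
  have htau : (Pᴴ * P).PosDef := by
    have := posDef_conj hP (Matrix.PosDef.one (n := n) (R := ℂ))
    simpa using this
  have hk : S k ≤ Ex μ (fun x => w x * rt (Pᴴ * f x * P * lg (Pᴴ * P))) := by
    refine Ex_le hμ fun x => mul_le_mul_of_nonneg_left ?_ (hw x)
    unfold rho
    rw [Dset_k, cE_univ h1]
    refine rt_lg_mono (posDef_conj hP (hf x)) htau ?_
    have := psd_conj P (hf1 x)
    rwa [Matrix.mul_sub, Matrix.sub_mul, Matrix.mul_one] at this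
  have hk2 : Ex μ (fun x => w x * rt (Pᴴ * cE μ C f x * P * lg (Pᴴ * P))) =
      Ex μ (fun x => w x * rt (Pᴴ * f x * P * lg (Pᴴ * P))) := by
    refine tower h1 C (fun x M => w x * rt (Pᴴ * M * P * lg (Pᴴ * P))) (fun x => lin_aux _ _ _) ?_ f
    intro x x' hx
    beta_reduce
    rw [hwd x x' hx]
  rw [← hk2] at hk
  refine (sub_le_sub_right hk _).trans ?_
  simp only [hS]
  rw [← Ex_sub]
  refine Ex_le hμ fun x => ?_
  rw [← mul_sub]
  refine mul_le_mul_of_nonneg_left ?_ (hw x)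
  unfold rho
  rw [Dset_zero]
  exact rt_ent (posDef_conj hP (cE_posDef hμ h1 C f hf x)) htau lam hlam
end ENT

section SIDE
variable {X Y : Type} [Fintype X] [Fintype Y] {k : ℕ} {μ : X → ℝ} {ν : Y → ℝ}
variable {n : Type} [Fintype n] [DecidableEq n]

lemma tau_lin_right (w : ℝ) (K A : Matrix n n ℂ) : IsLinearMap ℝ (fun M => w * tau K A M) := by
  constructor
  · intro M N; simp only [tau_add_right, mul_add]
  · intro c M; simp only [tau_smul_right, smul_eq_mul]; ring
lemma tau_lin_left (w : ℝ) (K B : Matrix n n ℂ) : IsLinearMap ℝ (fun M => w * tau K M B) := by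
  constructor
  · intro M N; simp only [tau_add_left, mul_add]
  · intro c M; simp only [tau_smul_left, smul_eq_mul]; ring

/-- double tower -/
lemma tower2 (h1 : ∑ x, μ x = 1) (g1 : ∑ y, ν y = 1) (S : Finset (Fin k)) (K : Matrix n n ℂ)
    (w : (Fin k → X) → (Fin k → Y) → ℝ) (hwx : DepOn S w) (hwy : ∀ x, DepOn S (w x))
    (f : (Fin k → X) → Matrix n n ℂ) (g : (Fin k → Y) → Matrix n n ℂ) :
    Ex μ (fun x => Ex ν (fun y => w x y * tau K (cE μ S f x) (cE ν S g y))) =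
      Ex μ (fun x => Ex ν (fun y => w x y * tau K (f x) (g y))) := by
  have e1 : ∀ x, Ex ν (fun y => w x y * tau K (cE μ S f x) (cE ν S g y)) =
      Ex ν (fun y => w x y * tau K (cE μ S f x) (g y)) := by
    intro x
    refine tower g1 S (fun y M => w x y * tau K (cE μ S f x) M) (fun y => tau_lin_right _ _ _) ?_ g
    intro y y' hy; beta_reduce; rw [hwy x y y' hy]
  have e2 : ∀ y, Ex μ (fun x => w x y * tau K (cE μ S f x) (g y)) =
      Ex μ (fun x => w x y * tau K (f x) (g y)) := by
    intro y
    refine tower h1 S (fun x M => w x y * tau K M (g y)) (fun x => tau_lin_left _ _ _) ?_ f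
    intro x x' hx; beta_reduce; rw [hwx x x' hx]
  have c1 : Ex μ (fun x => Ex ν (fun y => w x y * tau K (cE μ S f x) (g y))) =
    Ex ν (fun y => Ex μ (fun x => w x y * tau K (cE μ S f x) (g y))) :=
    Ex_comm (V := ℝ) (fun x y => w x y * tau K (cE μ S f x) (g y))
  have c2 : Ex μ (fun x => Ex ν (fun y => w x y * tau K (f x) (g y))) =
    Ex ν (fun y => Ex μ (fun x => w x y * tau K (f x) (g y))) :=
    Ex_comm (V := ℝ) (fun x y => w x y * tau K (f x) (g y))
  rw [c2, ← funext e2, ← c1, ← funext e1]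

/-- the frame operator -/
def Pfr (ν : Y → ℝ) (C : Finset (Fin k)) (K : Matrix n n ℂ) (g : (Fin k → Y) → Matrix n n ℂ) (y : Fin k → Y) :
    Matrix n n ℂ := K * pw (cE ν C g y) (1/2)

lemma Pfr_unit {K : Matrix n n ℂ} (hK : IsUnit K) (C : Finset (Fin k)) (g : (Fin k → Y) → Matrix n n ℂ)
    (y : Fin k → Y) : IsUnit (Pfr ν C K g y) := hK.mul (pw_isUnit _ _)

lemma Pfr_mul (hν : ∀ y, 0 ≤ ν y) (g1 : ∑ y, ν y = 1) (K : Matrix n n ℂ) (C : Finset (Fin k))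
    (g : (Fin k → Y) → Matrix n n ℂ) (hg : ∀ y, (g y).PosDef)
    (y : Fin k → Y) : Pfr ν C K g y * (Pfr ν C K g y)ᴴ = K * cE ν C g y * Kᴴ := by
  unfold Pfr
  conv_rhs => rw [← pw_half_mul (cE_posDef hν g1 C g hg y)]
  rw [conjTranspose_mul, pw_half_star]
  simp only [Matrix.mul_assoc]

/-- deviation operator -/
def Qdev (μ : X → ℝ) (C : Finset (Fin k)) (i : Fin k) (P : Matrix n n ℂ) (f : (Fin k → X) → Matrix n n ℂ)
    (θ : ℝ) (x : Fin k → X) : Matrix n n ℂ :=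
  ∑ x0, μ x0 • ((1 - Gam P (cE μ (Dset C (i.val + 1)) f (Function.update x i x0)) (cE μ (Dset C i.val) f x) θ)ᴴ *
    cE μ (Dset C (i.val + 1)) f (Function.update x i x0) *
    (1 - Gam P (cE μ (Dset C (i.val + 1)) f (Function.update x i x0)) (cE μ (Dset C i.val) f x) θ))

lemma cE_succ (h1 : ∑ x, μ x = 1) {C : Finset (Fin k)} {i : Fin k} (hi : i ∉ C)
    (f : (Fin k → X) → Matrix n n ℂ) (x : Fin k → X) :
    ∑ x0, μ x0 • cE μ (Dset C (i.val + 1)) f (Function.update x i x0) = cE μ (Dset C i.val) f x := by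
  rw [cE_insert h1 (Dset C i.val) i (not_mem_Dset hi), Dset_succ]

lemma dep_update {W : Type} {C : Finset (Fin k)} {i : Fin k} (hi : i ∉ C) {f : (Fin k → X) → W} (hf : DepOn C f)
    (x : Fin k → X) (x0 : X) : f (Function.update x i x0) = f x := by
  refine hf _ _ fun j hj => ?_
  rw [Function.update_of_ne]
  rintro rfl; exact hi hj

lemma Qdev_le (hμ : ∀ x, 0 ≤ μ x) (h1 : ∑ x, μ x = 1) {C : Finset (Fin k)} {i : Fin k} (hi : i ∉ C)
    {P : Matrix n n ℂ} (hP : IsUnit P) (f : (Fin k → X) → Matrix n n ℂ) (hf : ∀ x, (f x).PosDef)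
    (θ : ℝ) (t0 : 0 ≤ θ) (t1 : θ ≤ 1) (x : Fin k → X) :
    rt (Qdev μ C i P f θ x * (P * Pᴴ)) ≤ θ * ∑ x0, μ x0 * relent μ C P f i.val (Function.update x i x0) := by
  unfold Qdev
  rw [Matrix.sum_mul, rt_sum]
  have hsum : ∑ x0, μ x0 * rt (Pᴴ * cE μ (Dset C (i.val + 1)) f (Function.update x i x0) * P) =
      rt (Pᴴ * cE μ (Dset C i.val) f x * P) := by
    rw [← cE_succ h1 hi]
    simp only [Matrix.mul_sum, Matrix.sum_mul, rt_sum, Matrix.mul_smul, Matrix.smul_mul, rt_smul]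
  calc _ ≤ ∑ x0, μ x0 * (θ * (rt (Pᴴ * cE μ (Dset C i.val) f x * P) -
          rt (Pᴴ * cE μ (Dset C (i.val + 1)) f (Function.update x i x0) * P)) +
          θ * relent μ C P f i.val (Function.update x i x0)) := by
        refine Finset.sum_le_sum fun x0 _ => ?_
        rw [Matrix.smul_mul, rt_smul]
        refine mul_le_mul_of_nonneg_left ?_ (hμ x0)
        have := Gam_close hP (cE_posDef hμ h1 (Dset C (i.val + 1)) f hf (Function.update x i x0))
          (cE_posDef hμ h1 (Dset C i.val) f hf x) θ t0 t1
        unfold relent rho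
        rw [dep_update (not_mem_Dset hi) (cE_dep (μ := μ) (Dset C i.val) f)]
        exact this
    _ = θ * (rt (Pᴴ * cE μ (Dset C i.val) f x * P) * ∑ x0, μ x0) -
          θ * (∑ x0, μ x0 * rt (Pᴴ * cE μ (Dset C (i.val + 1)) f (Function.update x i x0) * P)) +
          θ * ∑ x0, μ x0 * relent μ C P f i.val (Function.update x i x0) := by
        simp only [Finset.mul_sum, ← Finset.sum_sub_distrib, ← Finset.sum_add_distrib]
        refine Finset.sum_congr rfl fun x0 _ => ?_
        ring
    _ = _ := by rw [hsum, h1]; ring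

lemma side1 (hμ : ∀ x, 0 ≤ μ x) (h1 : ∑ x, μ x = 1) (hν : ∀ y, 0 ≤ ν y) (g1 : ∑ y, ν y = 1)
    {C : Finset (Fin k)} {i : Fin k} (hi : i ∉ C)
    {K : Matrix n n ℂ} (hK : IsUnit K) (f : (Fin k → X) → Matrix n n ℂ) (hf : ∀ x, (f x).PosDef)
    (g : (Fin k → Y) → Matrix n n ℂ) (hg : ∀ y, (g y).PosDef)
    (w : (Fin k → X) → (Fin k → Y) → ℝ) (hw0 : ∀ x y, 0 ≤ w x y) (hwx : DepOn C w) (hwy : ∀ x, DepOn C (w x))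
    (θ : ℝ) (t0 : 0 ≤ θ) (t1 : θ ≤ 1) :
    Ex μ (fun x => Ex ν (fun y => w x y * tau K (Qdev μ C i (Pfr ν C K g y) f θ x) (cE ν (Dset C i.val) g y))) ≤
      θ * Ex μ (fun x => Ex ν (fun y => w x y * relent μ C (Pfr ν C K g y) f i.val x)) := by
  have e1 : ∀ x, Ex ν (fun y => w x y * tau K (Qdev μ C i (Pfr ν C K g y) f θ x) (cE ν (Dset C i.val) g y)) =
      Ex ν (fun y => w x y * tau K (Qdev μ C i (Pfr ν C K g y) f θ x) (cE ν C g y)) := by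
    intro x
    have ha : ∀ T, C ⊆ T → Ex ν (fun y => w x y * tau K (Qdev μ C i (Pfr ν C K g y) f θ x) (cE ν T g y)) =
        Ex ν (fun y => w x y * tau K (Qdev μ C i (Pfr ν C K g y) f θ x) (g y)) := by
      intro T hT
      refine tower g1 T (fun y M => w x y * tau K (Qdev μ C i (Pfr ν C K g y) f θ x) M)
        (fun y => tau_lin_right _ _ _) ?_ g
      intro y y' hy
      have hy' : ∀ i ∈ C, y i = y' i := fun i hi => hy i (hT hi)
      have e : Pfr ν C K g y = Pfr ν C K g y' := by
        unfold Pfr; rw [cE_dep C g y y' hy']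
      beta_reduce
      rw [hwy x y y' hy', e]
    rw [ha _ (C_sub_Dset C _), ha C (Finset.Subset.refl _)]
  simp only [e1]
  calc _ ≤ Ex μ (fun x => Ex ν (fun y => w x y * (θ * ∑ x0, μ x0 * relent μ C (Pfr ν C K g y) f i.val (Function.update x i x0)))) := by
        refine Ex_le hμ fun x => Ex_le hν fun y => mul_le_mul_of_nonneg_left ?_ (hw0 x y)
        rw [tau_eq, ← Pfr_mul hν g1 K C g hg y]
        exact Qdev_le hμ h1 hi (Pfr_unit hK C g y) f hf θ t0 t1 x
    _ = _ := by
        rw [Ex_comm, Ex_comm (f := fun x y => w x y * relent μ C (Pfr ν C K g y) f i.val x), ← Ex_mul]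
        congr 1; funext y
        rw [Ex_update h1 i (fun x => w x y * relent μ C (Pfr ν C K g y) f i.val x), ← Ex_mul]
        congr 1; funext x
        simp only [dep_update hi hwx, smul_eq_mul, Finset.mul_sum]
        refine Finset.sum_congr rfl fun x0 _ => ?_
        ring

lemma side2 (hμ : ∀ x, 0 ≤ μ x) (h1 : ∑ x, μ x = 1) (hν : ∀ y, 0 ≤ ν y) (g1 : ∑ y, ν y = 1)
    {C : Finset (Fin k)}
    {K : Matrix n n ℂ} (hK : IsUnit K) (f : (Fin k → X) → Matrix n n ℂ) (hf : ∀ x, (f x).PosDef)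
    (hf1 : ∀ x, (1 - f x).PosSemidef)
    (g : (Fin k → Y) → Matrix n n ℂ) (hg : ∀ y, (g y).PosDef)
    (w : (Fin k → X) → (Fin k → Y) → ℝ) (hw0 : ∀ x y, 0 ≤ w x y) (hw1 : ∀ x y, w x y ≤ 1)
    (hwx : DepOn C w) (hwy : ∀ x, DepOn C (w x)) (lam : ℝ) (hlam : 0 < lam) :
    ∑ i : Fin k, Ex μ (fun x => Ex ν (fun y => w x y * relent μ C (Pfr ν C K g y) f i.val x)) ≤
      (Real.log lam - 1) * Ex μ (fun x => Ex ν (fun y => w x y * tau K (f x) (g y))) +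
       (1 / lam) * Ex ν (fun y => tau K 1 (g y)) := by
  have e0 : ∀ i : Fin k, Ex μ (fun x => Ex ν (fun y => w x y * relent μ C (Pfr ν C K g y) f i.val x)) =
      Ex ν (fun y => Ex μ (fun x => w x y * relent μ C (Pfr ν C K g y) f i.val x)) := fun i => Ex_comm _
  simp only [e0]
  rw [← Ex_sum]
  have ef : ∀ x y, rt ((Pfr ν C K g y)ᴴ * cE μ C f x * Pfr ν C K g y) = tau K (cE μ C f x) (cE ν C g y) := by
    intro x y
    rw [tau_eq, ← Pfr_mul hν g1 K C g hg y, Matrix.mul_assoc, rt_comm, Matrix.mul_assoc]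
  have eg : ∀ y, rt ((Pfr ν C K g y)ᴴ * Pfr ν C K g y) = tau K 1 (cE ν C g y) := by
    intro y
    rw [tau_eq, ← Pfr_mul hν g1 K C g hg y, rt_comm, Matrix.one_mul]
  calc _ ≤ Ex ν (fun y => Ex μ (fun x => w x y * ((Real.log lam - 1) * tau K (cE μ C f x) (cE ν C g y)) +
          (1/lam) * tau K 1 (cE ν C g y))) := by
        refine Ex_le hν fun y => ?_
        refine (relent_sum hμ h1 C (Pfr_unit hK C g y) f hf hf1 (fun x => w x y) (fun x => hw0 x y)
          (fun x x' hx => by beta_reduce; rw [hwx x x' hx]) lam hlam).trans ?_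
        refine Ex_le hμ fun x => ?_
        rw [ef, eg]
        have t0 : 0 ≤ tau K 1 (cE ν C g y) := tau_nonneg K Matrix.PosSemidef.one (cE_posDef hν g1 C g hg y).posSemidef
        have : w x y * (tau K 1 (cE ν C g y) / lam) ≤ 1 * (tau K 1 (cE ν C g y) / lam) :=
          mul_le_mul_of_nonneg_right (hw1 x y) (by positivity)
        rw [show (1/lam) * tau K 1 (cE ν C g y) = 1 * (tau K 1 (cE ν C g y) / lam) by ring]
        linarith
    _ = _ := by
        simp only [Ex_add, Ex_const h1, Ex_mul]
        congr 1
        · rw [Ex_comm (f := fun y x => w x y * ((Real.log lam - 1) * tau K (cE μ C f x) (cE ν C g y))),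
            ← tower2 h1 g1 C K w hwx hwy f g, ← Ex_mul]
          congr 1; funext x
          rw [← Ex_mul]
          congr 1; funext y; ring
        · congr 1
          have := tower g1 C (fun _ M => 1 * tau K 1 M) (fun _ => tau_lin_right 1 K 1) (fun _ _ _ => rfl) g
          simpa only [one_mul] using this
end SIDE

section STEP
variable {X Y A B : Type} [Fintype X] [Fintype Y] [Fintype A] [Fintype B] {k : ℕ} {μ : X → ℝ} {ν : Y → ℝ}
variable {n : Type} [Fintype n] [DecidableEq n]

lemma update_to_gval (h1 : ∑ x, μ x = 1) (g1 : ∑ y, ν y = 1)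
    {C : Finset (Fin k)} {i : Fin k} (hi : i ∉ C) (v : X → Y → A → B → ℝ) (K : Matrix n n ℂ)
    (fa : A → (Fin k → X) → Matrix n n ℂ) (gb : B → (Fin k → Y) → Matrix n n ℂ)
    (w : (Fin k → X) → (Fin k → Y) → ℝ) (hwx : DepOn C w) (hwy : ∀ x, DepOn C (w x)) :
    Ex μ (fun x => Ex ν (fun y => ∑ a, ∑ b, w x y * v (x i) (y i) a b * tau K (fa a x) (gb b y))) =
    Ex μ (fun x => Ex ν (fun y => w x y * gval μ ν v K
      (fun x0 a => cE μ (Dset C (i.val + 1)) (fa a) (Function.update x i x0))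
      (fun y0 b => cE ν (Dset C (i.val + 1)) (gb b) (Function.update y i y0)))) := by
  set S := Dset C (i.val + 1) with hS
  have hiS : i ∈ S := by rw [hS, Dset_succ]; exact Finset.mem_insert_self _ _
  have hCS : C ⊆ S := C_sub_Dset C _
  have e1 : ∀ a b, Ex μ (fun x => Ex ν (fun y => w x y * v (x i) (y i) a b * tau K (fa a x) (gb b y))) =
      Ex μ (fun x => Ex ν (fun y => w x y * v (x i) (y i) a b * tau K (cE μ S (fa a) x) (cE ν S (gb b) y))) := by
    intro a b
    refine (tower2 h1 g1 S K (fun x y => w x y * v (x i) (y i) a b) ?_ ?_ (fa a) (gb b)).symm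
    · intro x x' h
      funext y; beta_reduce
      rw [hwx x x' fun j hj => h j (hCS hj), h i hiS]
    · intro x y y' h
      beta_reduce
      rw [hwy x y y' fun j hj => h j (hCS hj), h i hiS]
  have e2 : Ex μ (fun x => Ex ν (fun y => ∑ a, ∑ b, w x y * v (x i) (y i) a b * tau K (fa a x) (gb b y))) =
      Ex μ (fun x => Ex ν (fun y => ∑ a, ∑ b, w x y * v (x i) (y i) a b * tau K (cE μ S (fa a) x) (cE ν S (gb b) y))) := by
    simp only [Ex_sum]
    exact Finset.sum_congr rfl fun a _ => Finset.sum_congr rfl fun b _ => e1 a b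
  rw [e2, Ex_update h1 i]
  congr 1; funext x
  have e3 : ∀ x0, Ex ν (fun y => ∑ a, ∑ b, w (Function.update x i x0) y * v ((Function.update x i x0) i) (y i) a b *
      tau K (cE μ S (fa a) (Function.update x i x0)) (cE ν S (gb b) y)) =
      Ex ν (fun y => ∑ y0, ν y0 * ∑ a, ∑ b, w x y * v x0 y0 a b *
      tau K (cE μ S (fa a) (Function.update x i x0)) (cE ν S (gb b) (Function.update y i y0))) := by
    intro x0
    rw [Ex_update g1 i]
    congr 1; funext y
    simp only [dep_update hi hwx, dep_update hi (hwy x), Function.update_self, smul_eq_mul]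
  simp only [e3]
  simp only [← Ex_smul, ← Ex_sum]
  congr 1; funext y
  unfold gval
  simp only [Finset.mul_sum, smul_eq_mul]
  refine Finset.sum_congr rfl fun x0 _ => Finset.sum_congr rfl fun y0 _ =>
    Finset.sum_congr rfl fun a _ => Finset.sum_congr rfl fun b _ => ?_
  ring

/-- one step for fixed conditioning value -/
lemma one_step {ω : ℝ} {v : X → Y → A → B → ℝ} (hω : OmegaBound n μ ν v ω) (hω0 : 0 ≤ ω)
    (hμ : ∀ x, 0 ≤ μ x) (h1 : ∑ x, μ x = 1) (hν : ∀ y, 0 ≤ ν y) (g1 : ∑ y, ν y = 1)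
    (hv0 : ∀ x y a b, 0 ≤ v x y a b) (hv1 : ∀ x y a b, v x y a b ≤ 1)
    {C : Finset (Fin k)} {i : Fin k} (hi : i ∉ C) {K : Matrix n n ℂ} (hK : IsUnit K)
    (fa : A → (Fin k → X) → Matrix n n ℂ) (gb : B → (Fin k → Y) → Matrix n n ℂ)
    (hfa : ∀ a x, (fa a x).PosSemidef) (hgb : ∀ b y, (gb b y).PosSemidef)
    (f : (Fin k → X) → Matrix n n ℂ) (hf : ∀ x, (f x).PosDef)
    (g : (Fin k → Y) → Matrix n n ℂ) (hg : ∀ y, (g y).PosDef)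
    (hfs : ∀ x, ∑ a, fa a x = f x) (hgs : ∀ y, ∑ b, gb b y = g y)
    (w : (Fin k → X) → (Fin k → Y) → ℝ) (hw0 : ∀ x y, 0 ≤ w x y) (hwx : DepOn C w) (hwy : ∀ x, DepOn C (w x))
    (θ s : ℝ) (t0 : 0 ≤ θ) (t1 : θ ≤ 1) (hs : 0 < s) :
    Ex μ (fun x => Ex ν (fun y => ∑ a, ∑ b, w x y * v (x i) (y i) a b * tau K (fa a x) (gb b y))) ≤
      (1 + s) * ω ^ θ * Ex μ (fun x => Ex ν (fun y => w x y * tau K (f x) (g y))) +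
      2 * (1 + 1/s) * θ * (Ex μ (fun x => Ex ν (fun y => w x y * relent μ C (Pfr ν C K g y) f i.val x)) +
        Ex ν (fun y => Ex μ (fun x => w x y * relent ν C (Pfr μ C Kᴴ f x) g i.val y))) := by
  rw [update_to_gval h1 g1 hi v K fa gb w hwx hwy]
  have hKs : IsUnit Kᴴ := by
    have := hK.star
    rwa [Matrix.star_eq_conjTranspose] at this
  have hfs' : f = fun x => ∑ a, fa a x := funext fun x => (hfs x).symm
  have hgs' : g = fun y => ∑ b, gb b y := funext fun y => (hgs y).symm
  have main : ∀ x y, w x y * gval μ ν v K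
      (fun x0 a => cE μ (Dset C (i.val + 1)) (fa a) (Function.update x i x0))
      (fun y0 b => cE ν (Dset C (i.val + 1)) (gb b) (Function.update y i y0)) ≤
      (1 + s) * ω ^ θ * (w x y * tau K (cE μ (Dset C i.val) f x) (cE ν (Dset C i.val) g y)) +
      (2 * (1 + 1/s) * (w x y * tau K (Qdev μ C i (Pfr ν C K g y) f θ x) (cE ν (Dset C i.val) g y)) +
       2 * (1 + 1/s) * (w x y * tau Kᴴ (Qdev ν C i (Pfr μ C Kᴴ f x) g θ y) (cE μ (Dset C i.val) f x))) := by
    intro x y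
    have := interp hω hω0 hμ hν h1 g1 hv0 hv1 K
      (fun x0 a => cE μ (Dset C (i.val + 1)) (fa a) (Function.update x i x0))
      (fun y0 b => cE ν (Dset C (i.val + 1)) (gb b) (Function.update y i y0))
      (fun x0 a => cE_psd hμ _ _ (hfa a) _) (fun y0 b => cE_psd hν _ _ (hgb b) _)
      (Ax := fun x0 => cE μ (Dset C (i.val + 1)) f (Function.update x i x0))
      (By := fun y0 => cE ν (Dset C (i.val + 1)) g (Function.update y i y0))
      (Ab := cE μ (Dset C i.val) f x) (Bb := cE ν (Dset C i.val) g y)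
      (PA := Pfr ν C K g y) (PB := Pfr μ C Kᴴ f x)
      (fun x0 => cE_posDef hμ h1 _ _ hf _) (fun y0 => cE_posDef hν g1 _ _ hg _)
      (cE_posDef hμ h1 _ _ hf _) (cE_posDef hν g1 _ _ hg _)
      (fun x0 => by rw [hfs', cE_sum]) (fun y0 => by rw [hgs', cE_sum])
      (cE_succ h1 hi f x) (cE_succ g1 hi g y)
      (Pfr_unit hK C g y) (Pfr_unit hKs C f x) θ s t0 t1 hs
    rw [← tau_swap]
    have := mul_le_mul_of_nonneg_left this (hw0 x y)
    unfold Qdev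
    refine this.trans (le_of_eq ?_)
    ring
  have s1 := side1 hμ h1 hν g1 hi hK f hf g hg w hw0 hwx hwy θ t0 t1
  have s2 := side1 hν g1 hμ h1 hi hKs g hg f hf (fun y x => w x y) (fun y x => hw0 x y)
    (fun y y' h => funext fun x => hwy x y y' h) (fun y x x' h => by beta_reduce; rw [hwx x x' h]) θ t0 t1
  have c2 : Ex μ (fun x => Ex ν (fun y => w x y * tau Kᴴ (Qdev ν C i (Pfr μ C Kᴴ f x) g θ y) (cE μ (Dset C i.val) f x))) =
     Ex ν (fun y => Ex μ (fun x => w x y * tau Kᴴ (Qdev ν C i (Pfr μ C Kᴴ f x) g θ y) (cE μ (Dset C i.val) f x))) :=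
    Ex_comm (V := ℝ) (fun x y => w x y * tau Kᴴ (Qdev ν C i (Pfr μ C Kᴴ f x) g θ y) (cE μ (Dset C i.val) f x))
  rw [← c2] at s2
  have t2 := tower2 h1 g1 (Dset C i.val) K w (hwx.mono (C_sub_Dset C _)) (fun x => (hwy x).mono (C_sub_Dset C _)) f g
  calc _ ≤ _ := Ex_le hμ fun x => Ex_le hν fun y => main x y
    _ = (1 + s) * ω ^ θ * Ex μ (fun x => Ex ν (fun y => w x y * tau K (cE μ (Dset C i.val) f x) (cE ν (Dset C i.val) g y))) +
       (2 * (1 + 1/s) * Ex μ (fun x => Ex ν (fun y => w x y * tau K (Qdev μ C i (Pfr ν C K g y) f θ x) (cE ν (Dset C i.val) g y))) +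
       2 * (1 + 1/s) * Ex μ (fun x => Ex ν (fun y => w x y * tau Kᴴ (Qdev ν C i (Pfr μ C Kᴴ f x) g θ y) (cE μ (Dset C i.val) f x)))) := by
        simp only [Ex_add, Ex_mul]
    _ ≤ _ := by
        rw [t2]
        have hc : 0 ≤ 2 * (1 + 1/s) := by positivity
        have := mul_le_mul_of_nonneg_left s1 hc
        have := mul_le_mul_of_nonneg_left s2 hc
        linarith
end STEP

section FIB
variable {n : Type} [Fintype n] [DecidableEq n]

open Classical in
/-- fiber sum -/
def FB {I T : Type} [Fintype I] (g : I → T) (t : T) (M : I → Matrix n n ℂ) : Matrix n n ℂ :=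
  ∑ a, if g a = t then M a else 0

lemma FB_psd {I T : Type} [Fintype I] (g : I → T) (t : T) {M : I → Matrix n n ℂ} (hM : ∀ a, (M a).PosSemidef) :
    (FB g t M).PosSemidef := by
  classical
  refine Matrix.posSemidef_sum _ fun a _ => ?_
  split_ifs
  · exact hM a
  · exact Matrix.PosSemidef.zero

lemma FB_posDef {I T : Type} [Fintype I] (g : I → T) (t : T) {M : I → Matrix n n ℂ} (hM : ∀ a, (M a).PosDef)
    (ht : ∃ a, g a = t) : (FB g t M).PosDef := by
  classical
  obtain ⟨a, ha⟩ := ht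
  unfold FB
  rw [← Finset.add_sum_erase _ _ (Finset.mem_univ a), if_pos ha]
  refine (hM a).add_posSemidef (Matrix.posSemidef_sum _ fun a _ => ?_)
  split_ifs
  · exact (hM a).posSemidef
  · exact Matrix.PosSemidef.zero

lemma FB_compl {I T : Type} [Fintype I] (g : I → T) (t : T) {M : I → Matrix n n ℂ} (hM : ∀ a, (M a).PosSemidef)
    (h1 : ∑ a, M a = 1) : (1 - FB g t M).PosSemidef := by
  classical
  unfold FB
  rw [← h1, ← Finset.sum_sub_distrib]
  refine Matrix.posSemidef_sum _ fun a _ => ?_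
  split_ifs
  · simpa using Matrix.PosSemidef.zero
  · simpa using hM a

lemma FB_lin {I T : Type} [Fintype I] [Fintype T] (g : I → T) (M : I → Matrix n n ℂ)
    {W : Type} [AddCommGroup W] [Module ℝ W]
    (L : T → Matrix n n ℂ → W) (hL : ∀ t, IsLinearMap ℝ (L t)) :
    ∑ t, L t (FB g t M) = ∑ a, L (g a) (M a) := by
  classical
  have e : ∀ t, L t (FB g t M) = ∑ a, if g a = t then L t (M a) else 0 := by
    intro t
    have := map_sum ((hL t).mk' (L t)) (fun a => if g a = t then M a else 0) Finset.univ
    simp only [IsLinearMap.mk'_apply] at this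
    unfold FB
    rw [this]
    refine Finset.sum_congr rfl fun a _ => ?_
    split_ifs
    · rfl
    · exact (hL t).map_zero
  simp only [e]
  rw [Finset.sum_comm]
  simp

lemma FB_sum {I T : Type} [Fintype I] [Fintype T] (g : I → T) (M : I → Matrix n n ℂ) :
    ∑ t, FB g t M = ∑ a, M a :=
  FB_lin g M (fun _ M => M) (fun _ => ⟨fun _ _ => rfl, fun _ _ => rfl⟩)

lemma FB_pair {I T U : Type} [Fintype I] [Fintype U] (g : I → T) (h : I → U) (t : T) (M : I → Matrix n n ℂ) :
    ∑ u, FB (fun a => (g a, h a)) (t, u) M = FB g t M := by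
  classical
  unfold FB
  rw [Finset.sum_comm]
  refine Finset.sum_congr rfl fun a _ => ?_
  by_cases hg : g a = t
  · simp [hg]
  · simp [hg]

lemma FB_tau {I T J U : Type} [Fintype I] [Fintype T] [Fintype J] [Fintype U] (g : I → T) (h : J → U)
    (M : I → Matrix n n ℂ) (N : J → Matrix n n ℂ) (K : Matrix n n ℂ) (W : T → U → ℝ) :
    ∑ t, ∑ u, W t u * tau K (FB g t M) (FB h u N) = ∑ a, ∑ b, W (g a) (h b) * tau K (M a) (N b) := by
  have e1 : ∀ t, ∑ u, W t u * tau K (FB g t M) (FB h u N) = ∑ b, W t (h b) * tau K (FB g t M) (N b) := by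
    intro t
    exact FB_lin h N (fun u P => W t u * tau K (FB g t M) P) (fun u => tau_lin_right _ _ _)
  simp only [e1]
  rw [Finset.sum_comm, Finset.sum_comm (s := (Finset.univ : Finset I))]
  refine Finset.sum_congr rfl fun b _ => ?_
  exact FB_lin g M (fun t P => W t (h b) * tau K P (N b)) (fun u => tau_lin_left _ _ _)
end FIB

section STEP2
variable {X Y A B : Type} [Fintype X] [Fintype Y] [Fintype A] [Fintype B] {k : ℕ}
variable {n : Type} [Fintype n] [DecidableEq n]

open Classical in
/-- winning indicator on `C` -/
def wn (V : X → Y → A → B → Bool) {J : Type} (x : J → X) (y : J → Y) (a : J → A) (b : J → B) : ℝ :=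
  if ∀ j, V (x j) (y j) (a j) (b j) = true then 1 else 0

lemma wn_nonneg (V : X → Y → A → B → Bool) {J : Type} (x : J → X) (y : J → Y) (a : J → A) (b : J → B) :
    0 ≤ wn V x y a b := by unfold wn; split_ifs <;> norm_num
lemma wn_le (V : X → Y → A → B → Bool) {J : Type} (x : J → X) (y : J → Y) (a : J → A) (b : J → B) :
    wn V x y a b ≤ 1 := by unfold wn; split_ifs <;> norm_num

/-- restriction -/
def rs {Z : Type} (C : Finset (Fin k)) (z : Fin k → Z) : C → Z := fun j => z j

lemma rs_surj {Z : Type} [Nonempty Z] (C : Finset (Fin k)) (t : C → Z) : ∃ z, rs C z = t := by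
  classical
  refine ⟨fun j => if h : j ∈ C then t ⟨j, h⟩ else Classical.arbitrary Z, ?_⟩
  funext j; simp [rs]

lemma rs_dep {Z : Type} (C : Finset (Fin k)) (x x' : Fin k → Z) (h : ∀ i ∈ C, x i = x' i) : rs C x = rs C x' :=
  funext fun j => h j j.2

/-- the probability of winning on `C` -/
def prC (μ : X → ℝ) (ν : Y → ℝ) (V : X → Y → A → B → Bool) (K : Matrix n n ℂ)
    (Al : (Fin k → X) → (Fin k → A) → Matrix n n ℂ) (Bo : (Fin k → Y) → (Fin k → B) → Matrix n n ℂ)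
    (C : Finset (Fin k)) : ℝ :=
  Ex μ (fun x => Ex ν (fun y => ∑ a, ∑ b, wn V (rs C x) (rs C y) (rs C a) (rs C b) * tau K (Al x a) (Bo y b)))

variable {μ : X → ℝ} {ν : Y → ℝ} {V : X → Y → A → B → Bool} {K : Matrix n n ℂ}
    {Al : (Fin k → X) → (Fin k → A) → Matrix n n ℂ} {Bo : (Fin k → Y) → (Fin k → B) → Matrix n n ℂ}

lemma prC_eq (C : Finset (Fin k)) : prC μ ν V K Al Bo C =
    ∑ α : C → A, ∑ β : C → B, Ex μ (fun x => Ex ν (fun y => wn V (rs C x) (rs C y) α β *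
      tau K (FB (rs C) α (Al x)) (FB (rs C) β (Bo y)))) := by
  unfold prC
  simp only [← Ex_sum]
  congr 1; funext x; congr 1; funext y
  exact (FB_tau (rs C) (rs C) (Al x) (Bo y) K (fun α β => wn V (rs C x) (rs C y) α β)).symm

lemma wn_insert (C : Finset (Fin k)) (i : Fin k) (x : Fin k → X) (y : Fin k → Y)
    (a : Fin k → A) (b : Fin k → B) :
    wn V (rs (insert i C) x) (rs (insert i C) y) (rs (insert i C) a) (rs (insert i C) b) =
    wn V (rs C x) (rs C y) (rs C a) (rs C b) * (if V (x i) (y i) (a i) (b i) then 1 else 0) := by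
  unfold wn rs
  have : (∀ j : (insert i C : Finset (Fin k)), V (x j) (y j) (a j) (b j) = true) ↔
    (∀ j : C, V (x j) (y j) (a j) (b j) = true) ∧ V (x i) (y i) (a i) (b i) = true := by
    simp only [Subtype.forall, Finset.mem_insert, forall_eq_or_imp]
    tauto
  simp only [this]
  split_ifs <;> simp_all

lemma prC_insert (C : Finset (Fin k)) (i : Fin k) : prC μ ν V K Al Bo (insert i C) =
    ∑ α : C → A, ∑ β : C → B, Ex μ (fun x => Ex ν (fun y => ∑ a0, ∑ b0, wn V (rs C x) (rs C y) α β *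
      (if V (x i) (y i) a0 b0 then 1 else 0) *
      tau K (FB (fun a => (rs C a, a i)) (α, a0) (Al x)) (FB (fun b => (rs C b, b i)) (β, b0) (Bo y)))) := by
  unfold prC
  simp only [← Ex_sum]
  congr 1; funext x; congr 1; funext y
  simp only [wn_insert]
  have := FB_tau (fun a : Fin k → A => (rs C a, a i)) (fun b : Fin k → B => (rs C b, b i)) (Al x) (Bo y) K
    (fun p q => wn V (rs C x) (rs C y) p.1 q.1 * (if V (x i) (y i) p.2 q.2 then 1 else 0))
  rw [← this]
  simp only [Fintype.sum_prod_type]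
  refine Finset.sum_congr rfl fun α _ => ?_
  rw [Finset.sum_comm]

/-- Alice's entropy term -/
def HA (μ : X → ℝ) (ν : Y → ℝ) (V : X → Y → A → B → Bool) (K : Matrix n n ℂ)
    (Al : (Fin k → X) → (Fin k → A) → Matrix n n ℂ) (Bo : (Fin k → Y) → (Fin k → B) → Matrix n n ℂ)
    (C : Finset (Fin k)) (i : Fin k) : ℝ :=
  ∑ α : C → A, ∑ β : C → B, Ex μ (fun x => Ex ν (fun y => wn V (rs C x) (rs C y) α β *
      relent μ C (Pfr ν C K (fun y => FB (rs C) β (Bo y)) y) (fun x => FB (rs C) α (Al x)) i.val x))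

lemma HA_mem {C : Finset (Fin k)} {i : Fin k} (h : i ∈ C) : HA μ ν V K Al Bo C i = 0 := by
  unfold HA
  simp only [relent_of_mem h, mul_zero]
  simp [Ex]

lemma HA_sum [Nonempty A] [Nonempty B] (hμ : ∀ x, 0 ≤ μ x) (h1 : ∑ x, μ x = 1) (hν : ∀ y, 0 ≤ ν y) (g1 : ∑ y, ν y = 1)
    (hK : IsUnit K) (hA : ∀ x a, (Al x a).PosDef) (hB : ∀ y b, (Bo y b).PosDef)
    (hA1 : ∀ x, ∑ a, Al x a = 1) (hB1 : ∀ y, ∑ b, Bo y b = 1) (C : Finset (Fin k))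
    (hp : 0 < prC μ ν V K Al Bo C) (hN : 0 < tau K 1 1) :
    ∑ i, HA μ ν V K Al Bo C i ≤ prC μ ν V K Al Bo C *
      (C.card * Real.log (Fintype.card A) + Real.log (tau K 1 1 / prC μ ν V K Al Bo C)) := by
  classical
  set p := prC μ ν V K Al Bo C with hpd
  have hcA : (0:ℝ) < Fintype.card A := by exact_mod_cast Fintype.card_pos
  set lam : ℝ := (Fintype.card A : ℝ) ^ C.card * (tau K 1 1 / p) with hlam
  have hl0 : 0 < lam := by positivity
  have hlog : Real.log lam = C.card * Real.log (Fintype.card A) + Real.log (tau K 1 1 / p) := by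
    rw [hlam, Real.log_mul (by positivity) (by positivity), Real.log_pow]
  have e : ∑ i, HA μ ν V K Al Bo C i = ∑ α : C → A, ∑ β : C → B, ∑ i : Fin k,
    Ex μ (fun x => Ex ν (fun y => wn V (rs C x) (rs C y) α β *
      relent μ C (Pfr ν C K (fun y => FB (rs C) β (Bo y)) y) (fun x => FB (rs C) α (Al x)) i.val x)) := by
    unfold HA
    rw [Finset.sum_comm]
    refine Finset.sum_congr rfl fun α _ => ?_
    rw [Finset.sum_comm]
  rw [e]
  calc _ ≤ ∑ α : C → A, ∑ β : C → B, ((Real.log lam - 1) * Ex μ (fun x => Ex ν (fun y => wn V (rs C x) (rs C y) α β *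
      tau K (FB (rs C) α (Al x)) (FB (rs C) β (Bo y)))) + (1 / lam) * Ex ν (fun y => tau K 1 (FB (rs C) β (Bo y)))) := by
        refine Finset.sum_le_sum fun α _ => Finset.sum_le_sum fun β _ => ?_
        refine side2 hμ h1 hν g1 hK (fun x => FB (rs C) α (Al x)) (fun x => FB_posDef _ _ (hA x) (rs_surj C α))
          (fun x => FB_compl _ _ (fun a => (hA x a).posSemidef) (hA1 x))
          (fun y => FB (rs C) β (Bo y)) (fun y => FB_posDef _ _ (hB y) (rs_surj C β))
          (fun x y => wn V (rs C x) (rs C y) α β) (fun x y => wn_nonneg _ _ _ _ _) (fun x y => wn_le _ _ _ _ _)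
          ?_ ?_ lam hl0
        · intro x x' h; funext y; beta_reduce; rw [rs_dep C x x' h]
        · intro x y y' h; beta_reduce; rw [rs_dep C y y' h]
    _ = (Real.log lam - 1) * p + (1 / lam) * (Fintype.card (C → A) * tau K 1 1) := by
        simp only [Finset.sum_add_distrib, ← Finset.mul_sum]
        rw [← prC_eq C, ← hpd]
        congr 2
        have eb : ∑ β : C → B, Ex ν (fun y => tau K 1 (FB (rs C) β (Bo y))) = tau K 1 1 := by
          simp only [← Ex_sum, ← tau_sum_right, FB_sum, hB1, Ex_const g1]
        rw [eb, Finset.sum_const, nsmul_eq_mul, Finset.card_univ]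
    _ = _ := by
        have : (Fintype.card (C → A) : ℝ) = (Fintype.card A : ℝ) ^ C.card := by
          simp
        rw [this, hlog, hlam]
        have h3 : (Fintype.card A : ℝ) ^ C.card ≠ 0 := by positivity
        field_simp
        ring

/-- Bob's entropy term -/
def HB (μ : X → ℝ) (ν : Y → ℝ) (V : X → Y → A → B → Bool) (K : Matrix n n ℂ)
    (Al : (Fin k → X) → (Fin k → A) → Matrix n n ℂ) (Bo : (Fin k → Y) → (Fin k → B) → Matrix n n ℂ)
    (C : Finset (Fin k)) (i : Fin k) : ℝ := HA ν μ (fun y x b a => V x y a b) Kᴴ Bo Al C i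

lemma wn_swap {J : Type} (x : J → X) (y : J → Y) (a : J → A) (b : J → B) :
    wn (fun y x b a => V x y a b) y x b a = wn V x y a b := rfl

lemma prC_swap (C : Finset (Fin k)) : prC ν μ (fun y x b a => V x y a b) Kᴴ Bo Al C = prC μ ν V K Al Bo C := by
  unfold prC
  rw [Ex_comm]
  congr 1; funext x; congr 1; funext y
  rw [Finset.sum_comm]
  refine Finset.sum_congr rfl fun a _ => Finset.sum_congr rfl fun b _ => ?_
  rw [wn_swap, tau_swap K]

lemma step [Nonempty A] [Nonempty B] {ω : ℝ}
    (hω : OmegaBound n μ ν (fun x y a b => if V x y a b then (1:ℝ) else 0) ω) (hω0 : 0 ≤ ω)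
    (hμ : ∀ x, 0 ≤ μ x) (h1 : ∑ x, μ x = 1) (hν : ∀ y, 0 ≤ ν y) (g1 : ∑ y, ν y = 1)
    (hK : IsUnit K) (hA : ∀ x a, (Al x a).PosDef) (hB : ∀ y b, (Bo y b).PosDef)
    (hA1 : ∀ x, ∑ a, Al x a = 1) (hB1 : ∀ y, ∑ b, Bo y b = 1) (C : Finset (Fin k)) (hC : C.card < k)
    (hp : 0 < prC μ ν V K Al Bo C) (hN : 0 < tau K 1 1)
    (θ s : ℝ) (t0 : 0 ≤ θ) (t1 : θ ≤ 1) (hs : 0 < s) :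
    ∃ i, i ∉ C ∧ prC μ ν V K Al Bo (insert i C) ≤ prC μ ν V K Al Bo C * ((1 + s) * ω ^ θ +
      2 * (1 + 1/s) * θ * ((C.card * Real.log ((Fintype.card A : ℝ) * Fintype.card B) +
        2 * Real.log (tau K 1 1 / prC μ ν V K Al Bo C)) / (k - C.card))) := by
  classical
  set p := prC μ ν V K Al Bo C with hpd
  have hcA : (0:ℝ) < Fintype.card A := by exact_mod_cast Fintype.card_pos
  have hcB : (0:ℝ) < Fintype.card B := by exact_mod_cast Fintype.card_pos
  have hKs : IsUnit Kᴴ := by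
    have := hK.star
    rwa [Matrix.star_eq_conjTranspose] at this
  have hNs : tau Kᴴ 1 1 = tau K 1 1 := (tau_swap K 1 1).symm
  have sA := HA_sum hμ h1 hν g1 hK hA hB hA1 hB1 C hp hN
  have sB := HA_sum (V := fun y x b a => V x y a b) (K := Kᴴ) hν g1 hμ h1 hKs hB hA hB1 hA1 C (by rw [prC_swap]; exact hp) (by rw [hNs]; exact hN)
  rw [prC_swap, hNs] at sB
  rw [← hpd] at sA sB
  set T := p * (C.card * Real.log ((Fintype.card A : ℝ) * Fintype.card B) + 2 * Real.log (tau K 1 1 / p)) with hT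
  have tot : ∑ i, (HA μ ν V K Al Bo C i + HB μ ν V K Al Bo C i) ≤ T := by
    rw [Finset.sum_add_distrib, hT, Real.log_mul hcA.ne' hcB.ne']
    unfold HB
    refine (add_le_add sA sB).trans (le_of_eq ?_)
    ring
  have kc : (0:ℝ) < k - C.card := by
    have : (C.card : ℝ) < k := by exact_mod_cast hC
    linarith
  have hcc : ((Finset.univ \ C).card : ℝ) = k - C.card := by
    rw [Finset.card_sdiff_of_subset (Finset.subset_univ _), Finset.card_univ, Fintype.card_fin, Nat.cast_sub hC.le]
  have tot' : ∑ i ∈ Finset.univ \ C, (HA μ ν V K Al Bo C i + HB μ ν V K Al Bo C i) ≤ T := by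
    refine le_trans (le_of_eq ?_) tot
    refine Finset.sum_subset (Finset.subset_univ _) fun i _ hi => ?_
    have : i ∈ C := by simpa using hi
    unfold HB
    rw [HA_mem this, HA_mem this, add_zero]
  obtain ⟨i, hi, hle⟩ : ∃ i ∈ Finset.univ \ C, HA μ ν V K Al Bo C i + HB μ ν V K Al Bo C i ≤ T / (k - C.card) := by
    refine Finset.exists_le_of_sum_le ?_ ?_
    · rw [← Finset.card_pos]
      have : (0:ℝ) < ((Finset.univ \ C).card : ℝ) := by rw [hcc]; exact kc
      exact_mod_cast this
    · refine tot'.trans (le_of_eq ?_)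
      rw [Finset.sum_const, nsmul_eq_mul, hcc]
      field_simp
  have hiC : i ∉ C := by simpa using hi
  refine ⟨i, hiC, ?_⟩
  rw [prC_insert]
  have key : ∀ (α : C → A) (β : C → B), Ex μ (fun x => Ex ν (fun y => ∑ a0, ∑ b0, wn V (rs C x) (rs C y) α β *
      (if V (x i) (y i) a0 b0 then 1 else 0) *
      tau K (FB (fun a => (rs C a, a i)) (α, a0) (Al x)) (FB (fun b => (rs C b, b i)) (β, b0) (Bo y)))) ≤
      (1 + s) * ω ^ θ * Ex μ (fun x => Ex ν (fun y => wn V (rs C x) (rs C y) α β *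
      tau K (FB (rs C) α (Al x)) (FB (rs C) β (Bo y)))) +
      2 * (1 + 1/s) * θ * (Ex μ (fun x => Ex ν (fun y => wn V (rs C x) (rs C y) α β *
      relent μ C (Pfr ν C K (fun y => FB (rs C) β (Bo y)) y) (fun x => FB (rs C) α (Al x)) i.val x)) +
      Ex ν (fun y => Ex μ (fun x => wn V (rs C x) (rs C y) α β *
      relent ν C (Pfr μ C Kᴴ (fun x => FB (rs C) α (Al x)) x) (fun y => FB (rs C) β (Bo y)) i.val y))) := by
    intro α β
    refine one_step hω hω0 hμ h1 hν g1 (fun x y a b => by split_ifs <;> norm_num)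
      (fun x y a b => by split_ifs <;> norm_num) hiC hK
      (fun a0 x => FB (fun a => (rs C a, a i)) (α, a0) (Al x)) (fun b0 y => FB (fun b => (rs C b, b i)) (β, b0) (Bo y))
      (fun a0 x => FB_psd _ _ fun a => (hA x a).posSemidef) (fun b0 y => FB_psd _ _ fun b => (hB y b).posSemidef)
      (fun x => FB (rs C) α (Al x)) (fun x => FB_posDef _ _ (hA x) (rs_surj C α))
      (fun y => FB (rs C) β (Bo y)) (fun y => FB_posDef _ _ (hB y) (rs_surj C β))
      (fun x => FB_pair (rs C) (fun a => a i) α (Al x)) (fun y => FB_pair (rs C) (fun b => b i) β (Bo y))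
      (fun x y => wn V (rs C x) (rs C y) α β) (fun x y => wn_nonneg _ _ _ _ _)
      ?_ ?_ θ s t0 t1 hs
    · intro x x' h; funext y; beta_reduce; rw [rs_dep C x x' h]
    · intro x y y' h; beta_reduce; rw [rs_dep C y y' h]
  calc _ ≤ _ := Finset.sum_le_sum fun α _ => Finset.sum_le_sum fun β _ => key α β
    _ = (1 + s) * ω ^ θ * p + 2 * (1 + 1/s) * θ * (HA μ ν V K Al Bo C i + HB μ ν V K Al Bo C i) := by
        simp only [Finset.sum_add_distrib, ← Finset.mul_sum]
        rw [← prC_eq C, ← hpd]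
        congr 3
        unfold HB HA
        rw [Finset.sum_comm]
        rfl
    _ ≤ (1 + s) * ω ^ θ * p + 2 * (1 + 1/s) * θ * (T / (k - C.card)) := by
        have : 0 ≤ 2 * (1 + 1/s) * θ := by positivity
        have := mul_le_mul_of_nonneg_left hle this
        linarith
    _ = _ := by rw [hT]; ring
end STEP2

section ITER

lemma iterate_bound {k : ℕ} (p : Finset (Fin k) → ℝ) (N : ℝ) (hN : 0 < N) (h0 : p ∅ ≤ N)
    (mono : ∀ C, p Finset.univ ≤ p C) (l a b Q κ r : ℝ) (hb : 0 ≤ b) (hr0 : 0 ≤ r)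
    (hstep : ∀ C : Finset (Fin k), C.card < k → 0 < p C → ∃ i, i ∉ C ∧
      p (insert i C) ≤ p C * (a + b * ((C.card * l + 2 * Real.log (N / p C)) / (k - C.card))))
    (m : ℕ) (hm : m ≤ k) (hκ : ∀ j : ℕ, j < m → (j * l + 2 * Q) / ((k:ℝ) - j) ≤ κ) (hr : a + b * κ ≤ r) :
    p Finset.univ ≤ N * max (r ^ m) (Real.exp (-Q)) := by
  classical
  by_contra hcon
  push Not at hcon
  have hbig : ∀ C, N * Real.exp (-Q) < p C := fun C =>
    lt_of_le_of_lt (mul_le_mul_of_nonneg_left (le_max_right _ _) hN.le) (hcon.trans_le (mono C))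
  have hpos : ∀ C, 0 < p C := fun C => lt_trans (by positivity) (hbig C)
  have hlog : ∀ C, Real.log (N / p C) ≤ Q := by
    intro C
    rw [Real.log_le_iff_le_exp (div_pos hN (hpos C)), div_le_iff₀ (hpos C)]
    have := hbig C
    rw [Real.exp_neg] at this
    have he := Real.exp_pos Q
    rw [← div_eq_mul_inv, div_lt_iff₀ he] at this
    linarith
  have ind : ∀ j, j ≤ m → ∃ C : Finset (Fin k), C.card = j ∧ p C ≤ N * r ^ j := by
    intro j
    induction j with
    | zero => intro _; exact ⟨∅, rfl, by simpa using h0⟩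
    | succ j ih =>
      intro hj
      obtain ⟨C, hc, hp⟩ := ih (by omega)
      have hck : C.card < k := by omega
      obtain ⟨i, hi, hle⟩ := hstep C hck (hpos C)
      refine ⟨insert i C, by rw [Finset.card_insert_of_notMem hi, hc], hle.trans ?_⟩
      have hkj : (0:ℝ) < k - j := by
        have : (j:ℝ) < k := by exact_mod_cast (by omega : j < k)
        linarith
      have h2 : (C.card * l + 2 * Real.log (N / p C)) / ((k:ℝ) - C.card) ≤ κ := by
        refine le_trans ?_ (hκ j (by omega))
        rw [hc]
        refine div_le_div_of_nonneg_right ?_ hkj.le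
        have := hlog C
        linarith
      have h3 : a + b * ((C.card * l + 2 * Real.log (N / p C)) / ((k:ℝ) - C.card)) ≤ r := by
        have := mul_le_mul_of_nonneg_left h2 hb
        linarith
      calc _ ≤ p C * r := mul_le_mul_of_nonneg_left h3 (hpos C).le
        _ ≤ N * r ^ j * r := mul_le_mul_of_nonneg_right hp hr0
        _ = _ := by ring
  obtain ⟨C, _, hp⟩ := ind m le_rfl
  have := mul_le_mul_of_nonneg_left (le_max_left (r ^ m) (Real.exp (-Q))) hN.le
  linarith [mono C]

/-- numeric form of the iteration, budget `d` -/
lemma iterate_num {k : ℕ} (hk : 1 ≤ k) (p : Finset (Fin k) → ℝ) (N : ℝ) (hN : 0 < N) (h0 : p ∅ ≤ N)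
    (mono : ∀ C, p Finset.univ ≤ p C) (l a b d η : ℝ) (hl : 0 < l) (hb : 0 ≤ b) (hd : 0 ≤ d) (hdl : d ≤ 2 * l)
    (hη : 0 ≤ η) (hη1 : η ≤ 1) (hηl : η ≤ l / 2)
    (hstep : ∀ C : Finset (Fin k), C.card < k → 0 < p C → ∃ i, i ∉ C ∧
      p (insert i C) ≤ p C * (a + b * ((C.card * l + 2 * Real.log (N / p C)) / (k - C.card))))
    (hr : a + b * (d / 99) ≤ 1 - η) :
    p Finset.univ ≤ N * Real.exp (- (η * d * k / (200 * l))) := by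
  have hk0 : (1:ℝ) ≤ k := by exact_mod_cast hk
  set t : ℝ := d * k / (200 * l) with ht
  have ht0 : 0 ≤ t := by positivity
  have ht1 : t ≤ k / 100 := by
    rw [ht, div_le_div_iff₀ (by positivity) (by norm_num)]
    nlinarith
  have htl : t * l = d * k / 200 := by rw [ht]; field_simp
  set m := ⌊t⌋₊ + 1 with hm
  have hmk : m ≤ k := by
    have : ⌊t⌋₊ < k := by
      rw [Nat.floor_lt ht0]; linarith
    omega
  have hmt : t ≤ m := by
    have := (Nat.lt_floor_add_one t).le
    rw [hm]; push_cast; exact this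
  have := iterate_bound p N hN h0 mono l a b (d * k / 400) (d / 99) (1 - η) hb (by linarith) hstep m hmk ?_ hr
  · refine this.trans (mul_le_mul_of_nonneg_left (max_le ?_ ?_) hN.le)
    · calc (1 - η) ^ m ≤ (Real.exp (-η)) ^ m := by
            refine pow_le_pow_left₀ (by linarith) ?_ m
            have := Real.add_one_le_exp (-η); linarith
        _ = Real.exp (-(η * m)) := by rw [← Real.exp_nat_mul]; congr 1; ring
        _ ≤ _ := by
            refine Real.exp_le_exp.mpr ?_
            have := mul_le_mul_of_nonneg_left hmt hη
            have e : η * d * k / (200 * l) = η * t := by rw [ht]; ring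
            rw [e]; linarith
    · refine Real.exp_le_exp.mpr ?_
      have e : η * d * k / (200 * l) = η * t := by rw [ht]; ring
      rw [e]
      have : η * t ≤ l / 2 * t := mul_le_mul_of_nonneg_right hηl ht0
      have : l / 2 * t = d * k / 400 := by rw [mul_comm, mul_div_assoc', htl]; ring
      linarith
  · intro j hj
    have hjt : (j:ℝ) ≤ t := by
      have : j ≤ ⌊t⌋₊ := by omega
      exact (Nat.le_floor_iff ht0).mp this
    have hkj : (0:ℝ) < k - j := by linarith
    rw [div_le_iff₀ hkj]
    have h1 : (j:ℝ) * l ≤ d * k / 200 := by rw [← htl]; exact mul_le_mul_of_nonneg_right hjt hl.le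
    have h2 : (99:ℝ)/100 * k ≤ k - j := by linarith
    have h3 : d / 99 * (99/100 * k) ≤ d / 99 * (k - j) := mul_le_mul_of_nonneg_left h2 (by positivity)
    nlinarith
end ITER

section NICE
variable {X Y A B : Type} [Fintype X] [Fintype Y] [Fintype A] [Fintype B] {k : ℕ}
variable {n : Type} [Fintype n] [DecidableEq n]
variable {μ : X → ℝ} {ν : Y → ℝ} {V : X → Y → A → B → Bool} {K : Matrix n n ℂ}
    {Al : (Fin k → X) → (Fin k → A) → Matrix n n ℂ} {Bo : (Fin k → Y) → (Fin k → B) → Matrix n n ℂ}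

lemma prC_empty (h1 : ∑ x, μ x = 1) (g1 : ∑ y, ν y = 1)
    (hA1 : ∀ x, ∑ a, Al x a = 1) (hB1 : ∀ y, ∑ b, Bo y b = 1) : prC μ ν V K Al Bo ∅ = tau K 1 1 := by
  unfold prC
  have e : ∀ (x : Fin k → X) (y : Fin k → Y) (a : Fin k → A) (b : Fin k → B),
     wn V (rs ∅ x) (rs ∅ y) (rs ∅ a) (rs ∅ b) = 1 := by
    intro x y a b; unfold wn; rw [if_pos]; rintro ⟨j, hj⟩; simp at hj
  simp only [e, one_mul, ← tau_sum_right, ← tau_sum_left, hA1, hB1, Ex_const h1, Ex_const g1]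

lemma prC_mono (hμ : ∀ x, 0 ≤ μ x) (hν : ∀ y, 0 ≤ ν y)
    (hA : ∀ x a, (Al x a).PosSemidef) (hB : ∀ y b, (Bo y b).PosSemidef) (C : Finset (Fin k)) :
    prC μ ν V K Al Bo Finset.univ ≤ prC μ ν V K Al Bo C := by
  refine Ex_le hμ fun x => Ex_le hν fun y => Finset.sum_le_sum fun a _ => Finset.sum_le_sum fun b _ => ?_
  refine mul_le_mul_of_nonneg_right ?_ (tau_nonneg K (hA x a) (hB y b))
  by_cases h : ∀ j : (Finset.univ : Finset (Fin k)), V (rs Finset.univ x j) (rs Finset.univ y j) (rs Finset.univ a j) (rs Finset.univ b j) = true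
  · have h' : ∀ j : C, V (rs C x j) (rs C y j) (rs C a j) (rs C b j) = true := fun j => h ⟨j, Finset.mem_univ _⟩
    unfold wn
    rw [if_pos h, if_pos h']
  · have : wn V (rs Finset.univ x) (rs Finset.univ y) (rs Finset.univ a) (rs Finset.univ b) = 0 := by
      unfold wn; rw [if_neg h]
    rw [this]; exact wn_nonneg _ _ _ _ _

open Classical in
/-- winnability -/
def wb (V : X → Y → A → B → Bool) (x : X) (y : Y) : ℝ := if ∃ a b, V x y a b = true then 1 else 0

lemma wb_nonneg (x : X) (y : Y) : 0 ≤ wb V x y := by unfold wb; split_ifs <;> norm_num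

lemma omega_ge [Nonempty A] [Nonempty B] {ω : ℝ}
    (hω : OmegaBound n μ ν (fun x y a b => if V x y a b then (1:ℝ) else 0) ω)
    (hμ : ∀ x, 0 ≤ μ x) (hν : ∀ y, 0 ≤ ν y) (hN : 0 < tau K 1 1) :
    ∑ x, ∑ y, μ x * ν y * wb V x y ≤ ω * ((Fintype.card A : ℝ) * Fintype.card B) := by
  classical
  have hcA : (0:ℝ) < Fintype.card A := by exact_mod_cast Fintype.card_pos
  have hcB : (0:ℝ) < Fintype.card B := by exact_mod_cast Fintype.card_pos
  have := hω K (fun _ _ => (Fintype.card A : ℝ)⁻¹ • 1) (fun _ _ => (Fintype.card B : ℝ)⁻¹ • 1)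
    (fun _ _ => Matrix.PosSemidef.one.smul (inv_nonneg.mpr hcA.le)) (fun _ _ => Matrix.PosSemidef.one.smul (inv_nonneg.mpr hcB.le))
    (fun _ => by rw [Finset.sum_const, Finset.card_univ, ← Nat.cast_smul_eq_nsmul ℝ, smul_smul, mul_inv_cancel₀ hcA.ne', one_smul])
    (fun _ => by rw [Finset.sum_const, Finset.card_univ, ← Nat.cast_smul_eq_nsmul ℝ, smul_smul, mul_inv_cancel₀ hcB.ne', one_smul])
  unfold gval at this
  simp only [tau_smul_left, tau_smul_right] at this
  have h2 : (∑ x, ∑ y, μ x * ν y * wb V x y) * ((Fintype.card B : ℝ)⁻¹ * ((Fintype.card A : ℝ)⁻¹ * tau K 1 1)) ≤ ω * tau K 1 1 := by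
    refine le_trans ?_ this
    simp only [Finset.sum_mul]
    refine Finset.sum_le_sum fun x _ => Finset.sum_le_sum fun y _ => ?_
    simp only [← Finset.sum_mul, ← Finset.mul_sum]
    have hpos : 0 ≤ (Fintype.card B : ℝ)⁻¹ * ((Fintype.card A : ℝ)⁻¹ * tau K 1 1) := by positivity
    refine mul_le_mul_of_nonneg_right (mul_le_mul_of_nonneg_left ?_ (mul_nonneg (hμ x) (hν y))) hpos
    unfold wb
    split_ifs with h
    · obtain ⟨a, b, hab⟩ := h
      calc (1:ℝ) = if V x y a b then 1 else 0 := by simp [hab]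
        _ ≤ ∑ b, if V x y a b then (1:ℝ) else 0 :=
          Finset.single_le_sum (f := fun b => if V x y a b then (1:ℝ) else 0) (fun b _ => by split_ifs <;> norm_num) (Finset.mem_univ b)
        _ ≤ _ := Finset.single_le_sum (f := fun a => ∑ b, if V x y a b then (1:ℝ) else 0)
            (fun a _ => Finset.sum_nonneg fun b _ => by split_ifs <;> norm_num) (Finset.mem_univ a)
    · exact Finset.sum_nonneg fun a _ => Finset.sum_nonneg fun b _ => by split_ifs <;> norm_num
  have h3 : (∑ x, ∑ y, μ x * ν y * wb V x y) * ((Fintype.card B : ℝ)⁻¹ * ((Fintype.card A : ℝ)⁻¹ * tau K 1 1)) =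
    (∑ x, ∑ y, μ x * ν y * wb V x y) / ((Fintype.card A : ℝ) * (Fintype.card B : ℝ)) * tau K 1 1 := by field_simp
  rw [h3] at h2
  have := le_of_mul_le_mul_right h2 hN
  rwa [div_le_iff₀ (by positivity)] at this

lemma Ex_prod_pow (F : X → Y → ℝ) :
    Ex μ (fun x : Fin k → X => Ex ν (fun y => ∏ j, F (x j) (y j))) = (∑ x, ∑ y, μ x * ν y * F x y) ^ k := by
  classical
  rw [← Fintype.sum_prod_type' (f := fun x y => μ x * ν y * F x y), Fintype.sum_pow]
  have e := Fintype.sum_equiv (Equiv.arrowProdEquivProdArrow (Fin k) (fun _ => X) (fun _ => Y))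
    (fun z => ∏ i, μ (z i).1 * ν (z i).2 * F (z i).1 (z i).2)
    (fun p => ∏ i, μ (p.1 i) * ν (p.2 i) * F (p.1 i) (p.2 i)) (fun z => rfl)
  rw [e, Fintype.sum_prod_type]
  unfold Ex pm
  simp only [Finset.prod_mul_distrib, smul_eq_mul, Finset.mul_sum, mul_assoc]

lemma prC_wb (hμ : ∀ x, 0 ≤ μ x) (hν : ∀ y, 0 ≤ ν y)
    (hA : ∀ x a, (Al x a).PosSemidef) (hB : ∀ y b, (Bo y b).PosSemidef)
    (hA1 : ∀ x, ∑ a, Al x a = 1) (hB1 : ∀ y, ∑ b, Bo y b = 1) :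
    prC μ ν V K Al Bo Finset.univ ≤ (∑ x, ∑ y, μ x * ν y * wb V x y) ^ k * tau K 1 1 := by
  rw [← Ex_prod_pow]
  have : Ex μ (fun x : Fin k → X => Ex ν (fun y => ∏ j, wb V (x j) (y j))) * tau K 1 1 =
    Ex μ (fun x : Fin k → X => Ex ν (fun y => ∑ a, ∑ b, (∏ j, wb V (x j) (y j)) * tau K (Al x a) (Bo y b))) := by
    simp only [← Finset.mul_sum, ← tau_sum_right, ← tau_sum_left, hA1, hB1]
    rw [mul_comm, ← Ex_mul]
    congr 1; funext x; rw [← Ex_mul]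
    congr 1; funext y; rw [mul_comm]
  rw [this]
  refine Ex_le hμ fun x => Ex_le hν fun y => Finset.sum_le_sum fun a _ => Finset.sum_le_sum fun b _ => ?_
  refine mul_le_mul_of_nonneg_right ?_ (tau_nonneg K (hA x a) (hB y b))
  by_cases h : ∀ j, V (x j) (y j) (a j) (b j) = true
  · have : ∏ j, wb V (x j) (y j) = 1 := Finset.prod_eq_one fun j _ => by
      unfold wb; rw [if_pos ⟨a j, b j, h j⟩]
    rw [this]; exact wn_le _ _ _ _ _
  · have : wn V (rs Finset.univ x) (rs Finset.univ y) (rs Finset.univ a) (rs Finset.univ b) = 0 := by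
      unfold wn; rw [if_neg]
      intro h'; exact h fun j => h' ⟨j, Finset.mem_univ _⟩
    rw [this]; exact Finset.prod_nonneg fun j _ => wb_nonneg _ _
end NICE

section NICEB
variable {X Y A B : Type} [Fintype X] [Fintype Y] [Fintype A] [Fintype B] {k : ℕ}
variable {n : Type} [Fintype n] [DecidableEq n]
variable {μ : X → ℝ} {ν : Y → ℝ} {V : X → Y → A → B → Bool} {K : Matrix n n ℂ}
    {Al : (Fin k → X) → (Fin k → A) → Matrix n n ℂ} {Bo : (Fin k → Y) → (Fin k → B) → Matrix n n ℂ}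

lemma nice_bound [Nonempty A] [Nonempty B] {ω : ℝ}
    (hω : OmegaBound n μ ν (fun x y a b => if V x y a b then (1:ℝ) else 0) ω) (hω0 : 0 ≤ ω) (hω1 : ω ≤ 1)
    (hμ : ∀ x, 0 ≤ μ x) (h1 : ∑ x, μ x = 1) (hν : ∀ y, 0 ≤ ν y) (g1 : ∑ y, ν y = 1)
    (hK : IsUnit K) (hA : ∀ x a, (Al x a).PosDef) (hB : ∀ y b, (Bo y b).PosDef)
    (hA1 : ∀ x, ∑ a, Al x a = 1) (hB1 : ∀ y, ∑ b, Bo y b = 1)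
    (hN : 0 < tau K 1 1) (hk : 1 ≤ k) (hcard : 2 ≤ Fintype.card A * Fintype.card B) :
    prC μ ν V K Al Bo Finset.univ ≤ tau K 1 1 * (1 - (1 - ω) ^ 3) ^
      ((1/2000) * (k:ℝ) / Real.logb 2 ((Fintype.card A : ℝ) * Fintype.card B)) := by
  set p := fun C => prC μ ν V K Al Bo C with hp
  set N := tau K 1 1 with hNd
  set l := Real.log ((Fintype.card A : ℝ) * Fintype.card B) with hl
  have hS : (2:ℝ) ≤ (Fintype.card A : ℝ) * Fintype.card B := by exact_mod_cast hcard
  have ln2a : 0.69 < Real.log 2 := by have := Real.log_two_gt_d9; linarith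
  have ln2b : Real.log 2 < 0.7 := by have := Real.log_two_lt_d9; linarith
  have hl2 : Real.log 2 ≤ l := Real.log_le_log (by norm_num) hS
  have hl0 : 0 < l := by linarith
  have hk0 : (1:ℝ) ≤ k := by exact_mod_cast hk
  set E := (1/2000) * (k:ℝ) / Real.logb 2 ((Fintype.card A : ℝ) * Fintype.card B) with hE
  have hE' : E = (1/2000) * k * Real.log 2 / l := by
    rw [hE, Real.logb, ← hl]; field_simp
  have hE0 : 0 < E := by rw [hE']; positivity
  have p0 : p ∅ ≤ N := (prC_empty h1 g1 hA1 hB1).le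
  have pm : ∀ C, p Finset.univ ≤ p C :=
    prC_mono hμ hν (fun x a => (hA x a).posSemidef) (fun y b => (hB y b).posSemidef)
  have st : ∀ θ s : ℝ, 0 ≤ θ → θ ≤ 1 → 0 < s → ∀ C : Finset (Fin k), C.card < k → 0 < p C → ∃ i, i ∉ C ∧
      p (insert i C) ≤ p C * ((1 + s) * ω ^ θ + 2 * (1 + 1/s) * θ * ((C.card * l + 2 * Real.log (N / p C)) / (k - C.card))) :=
    fun θ s t0 t1 hs C hC hpC => step hω hω0 hμ h1 hν g1 hK hA hB hA1 hB1 C hC hpC hN θ s t0 t1 hs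
  -- the winnable mass
  have wbB := prC_wb (V := V) (K := K) hμ hν (fun x a => (hA x a).posSemidef) (fun y b => (hB y b).posSemidef) hA1 hB1
  have wbO := omega_ge hω hμ hν hN
  set q := ∑ x, ∑ y, μ x * ν y * wb V x y with hq
  have q0 : 0 ≤ q := Finset.sum_nonneg fun x _ => Finset.sum_nonneg fun y _ =>
    mul_nonneg (mul_nonneg (hμ x) (hν y)) (wb_nonneg x y)
  rcases eq_or_lt_of_le hω0 with h | hωpos
  · have : q = 0 := by
      rw [← h, zero_mul] at wbO; linarith
    rw [this, zero_pow (by omega), zero_mul] at wbB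
    refine wbB.trans ?_
    rw [← h]; norm_num
    exact mul_nonneg hN.le (Real.rpow_nonneg le_rfl _)
  rcases eq_or_lt_of_le hω1 with h | hωlt
  · rw [h]
    refine ((pm ∅).trans p0).trans ?_
    norm_num
  by_cases hhalf : 1/2 ≤ ω
  · -- small gap
    set ε := 1 - ω with hε
    have e0 : 0 < ε := by linarith
    have e1 : ε ≤ 1/2 := by linarith
    have := iterate_num hk p N hN p0 pm l ((1 + ε/2) * ω ^ (1:ℝ)) (2 * (1 + 1/(ε/2)) * 1) (ε^2) (ε/4) hl0
      (by positivity) (by positivity) (by nlinarith) (by positivity) (by linarith) (by linarith)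
      (st 1 (ε/2) (by norm_num) le_rfl (by positivity)) ?_
    · refine this.trans (mul_le_mul_of_nonneg_left ?_ hN.le)
      have hb : Real.exp (-(2 * ε^3)) ≤ 1 - ε^3 := by
        have h3 : ε^3 ≤ 1/8 := by
          have := pow_le_pow_left₀ e0.le e1 3; norm_num at this; linarith
        have h30 : 0 < ε^3 := by positivity
        rw [Real.exp_neg, inv_le_comm₀ (Real.exp_pos _) (by linarith)]
        have := Real.add_one_le_exp (2 * ε^3)
        refine le_trans ?_ this
        rw [inv_le_iff_one_le_mul₀ (by linarith)]
        nlinarith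
      calc _ ≤ Real.exp (-(2 * ε^3)) ^ E := by
            rw [← Real.exp_mul]
            refine Real.exp_le_exp.mpr ?_
            rw [hE']
            have h30 : 0 < ε^3 := by positivity
            have : -(2 * ε^3) * ((1/2000) * k * Real.log 2 / l) = - ((ε^3 * k / l) * (Real.log 2 / 1000)) := by ring
            rw [this]
            have : ε / 4 * ε^2 * k / (200 * l) = (ε^3 * k / l) * (1/800) := by ring
            rw [this]
            have h4 : 0 ≤ ε^3 * k / l := by positivity
            have := mul_le_mul_of_nonneg_left (show Real.log 2 / 1000 ≤ 1/800 by linarith) h4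
            linarith
        _ ≤ _ := Real.rpow_le_rpow (Real.exp_pos _).le hb hE0.le
    · rw [Real.rpow_one]
      have : 2 * (1 + 1/(ε/2)) * 1 * (ε^2/99) = (2 * ε^2 + 4 * ε)/99 := by field_simp; ring
      rw [this]
      have : ω = 1 - ε := by rw [hε]; ring
      rw [this]
      nlinarith
  · push Not at hhalf
    set g := - Real.log ω with hg
    have hωg : ω = Real.exp (-g) := by rw [hg, neg_neg, Real.exp_log hωpos]
    have hg0 : Real.log 2 < g := by
      rw [hg, ← Real.log_inv]
      refine Real.log_lt_log (by norm_num) ?_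
      rw [lt_inv_comm₀ (by norm_num) hωpos]; linarith
    have gpos : 0 < g := by linarith
    have target : Real.exp (-(g * k / (1600 * l))) ≤ (1 - (1 - ω)^3) ^ E := by
      have hb : ω ≤ 1 - (1 - ω)^3 := by
        have : 0 ≤ (1 - ω) * (1 - (1 - ω)^2) := mul_nonneg (by linarith) (by nlinarith)
        nlinarith
      refine le_trans ?_ (Real.rpow_le_rpow hω0 hb hE0.le)
      rw [hωg, ← Real.exp_mul]
      refine Real.exp_le_exp.mpr ?_
      rw [hE']
      have e1 : -g * ((1/2000) * k * Real.log 2 / l) = - ((g * k / l) * (Real.log 2 / 2000)) := by ring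
      have e2 : g * k / (1600 * l) = (g * k / l) * (1/1600) := by ring
      rw [e1, e2]
      have h4 : 0 ≤ g * k / l := by positivity
      have := mul_le_mul_of_nonneg_left (show Real.log 2 / 2000 ≤ 1/1600 by linarith) h4
      linarith
    by_cases hgl : g ≤ 2 * l
    · have := iterate_num hk p N hN p0 pm l ((1 + 1/2) * ω ^ (Real.log 2 / g)) (2 * (1 + 1/(1/2)) * (Real.log 2 / g)) g (1/8) hl0
        (by positivity) gpos.le hgl (by positivity) (by norm_num) (by linarith)
        (st (Real.log 2 / g) (1/2) (by positivity) (by rw [div_le_one gpos]; exact hg0.le) (by norm_num)) ?_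
      · refine this.trans (mul_le_mul_of_nonneg_left (le_trans (le_of_eq ?_) target) hN.le)
        congr 2; ring
      · have e1 : ω ^ (Real.log 2 / g) = 1/2 := by
          rw [hωg, ← Real.exp_mul, show -g * (Real.log 2 / g) = - Real.log 2 by field_simp, Real.exp_neg,
            Real.exp_log (by norm_num)]; norm_num
        have e2 : 2 * (1 + 1/(1/2)) * (Real.log 2 / g) * (g / 99) = 6 * Real.log 2 / 99 := by field_simp; ring
        rw [e1, e2]
        linarith
    · push Not at hgl
      have hql : q ≤ Real.exp (-(g/2)) := by
        have : (Fintype.card A : ℝ) * Fintype.card B = Real.exp l := by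
          rw [hl, Real.exp_log (by linarith)]
        rw [this, hωg, ← Real.exp_add] at wbO
        refine wbO.trans (Real.exp_le_exp.mpr (by linarith))
      have : q ^ k ≤ (1 - (1 - ω)^3) ^ E := by
        refine (pow_le_pow_left₀ q0 hql k).trans (le_trans ?_ target)
        rw [← Real.exp_nat_mul]
        refine Real.exp_le_exp.mpr ?_
        have : g * k / (1600 * l) ≤ g * k / 2 := by
          refine div_le_div_of_nonneg_left (by positivity) (by norm_num) (by linarith)
        linarith
      calc _ ≤ q ^ k * N := wbB
        _ ≤ _ := by rw [mul_comm]; exact mul_le_mul_of_nonneg_left this hN.le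
end NICEB

section RED

lemma wp_trace {dA dB : Type} [Fintype dA] [Fintype dB] (K : Matrix dA dB ℂ)
    (A : Matrix dA dA ℂ) (B : Matrix dB dB ℂ) :
    star (fun p : dA × dB => K p.1 p.2) ⬝ᵥ ((A ⊗ₖ B) *ᵥ (fun p : dA × dB => K p.1 p.2)) =
      trace (Kᴴ * A * K * Bᵀ) := by
  simp only [dotProduct, mulVec, trace, Matrix.mul_apply, diag_apply, conjTranspose_apply, transpose_apply,
    kroneckerMap_apply, Pi.star_apply, Fintype.sum_prod_type, Finset.sum_mul, Finset.mul_sum]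
  rw [Finset.sum_comm]
  refine Finset.sum_congr rfl fun j _ => ?_
  rw [Finset.sum_comm' (t' := Finset.univ) (s' := fun _ => Finset.univ) (by simp)]
  simp_rw [Finset.sum_comm (s := (Finset.univ : Finset dB)) (t := (Finset.univ : Finset dA))]
  refine Finset.sum_congr rfl fun i _ => ?_
  refine Finset.sum_congr rfl fun i' _ => Finset.sum_congr rfl fun j' _ => ?_
  ring

lemma pad_term {dA dB : ℕ} (ψ : Fin dA × Fin dB → ℂ) (A : Matrix (Fin dA) (Fin dA) ℂ) (B : Matrix (Fin dB) (Fin dB) ℂ)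
    (P : Matrix (Fin dB) (Fin dB) ℂ) (Q : Matrix (Fin dA) (Fin dA) ℂ) :
    (star ψ ⬝ᵥ ((A ⊗ₖ B) *ᵥ ψ)).re =
      tau (fromBlocks 0 (Matrix.of fun i j => ψ (i, j)) 0 0) (fromBlocks A 0 0 P) (fromBlocks Q 0 0 Bᵀ) := by
  have := wp_trace (Matrix.of fun i j => ψ (i, j)) A B
  simp only [Matrix.of_apply, Prod.mk.eta] at this
  rw [this]
  unfold tau rt
  have tb : ∀ Z : Matrix (Fin dB) (Fin dB) ℂ,
      trace (fromBlocks (0 : Matrix (Fin dA) (Fin dA) ℂ) 0 0 Z) = trace Z := by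
    intro Z
    simp [Matrix.trace, Fintype.sum_sum_type]
  simp [fromBlocks_conjTranspose, fromBlocks_multiply, tb]

lemma pad_psd {p q : Type} [Fintype p] [Fintype q] [DecidableEq p] [DecidableEq q] {A : Matrix p p ℂ} {P : Matrix q q ℂ}
    (hA : A.PosSemidef) (hP : P.PosSemidef) : (fromBlocks A 0 0 P).PosSemidef := by
  obtain ⟨S, rfl⟩ := exists_sqrt hA
  obtain ⟨R, rfl⟩ := exists_sqrt hP
  have : fromBlocks (Sᴴ * S) 0 0 (Rᴴ * R) = (fromBlocks S 0 0 R)ᴴ * (fromBlocks S 0 0 R) := by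
    simp [fromBlocks_conjTranspose, fromBlocks_multiply]
  rw [this]
  exact posSemidef_conjTranspose_mul_self _

/-- padded Alice -/
def padA {A : Type} [Fintype A] {p q : Type} [DecidableEq q] (E : A → Matrix p p ℂ) (a : A) : Matrix (p ⊕ q) (p ⊕ q) ℂ :=
  fromBlocks (E a) 0 0 ((Fintype.card A : ℝ)⁻¹ • 1)
/-- padded Bob -/
def padB {B : Type} [Fintype B] {p q : Type} [DecidableEq p] (F : B → Matrix q q ℂ) (b : B) : Matrix (p ⊕ q) (p ⊕ q) ℂ :=
  fromBlocks ((Fintype.card B : ℝ)⁻¹ • 1) 0 0 (F b)ᵀ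

lemma unif_sum {A q : Type} [Fintype A] [Nonempty A] [DecidableEq q] :
    ∑ _a : A, (Fintype.card A : ℝ)⁻¹ • (1 : Matrix q q ℂ) = 1 := by
  have hcA : (0:ℝ) < Fintype.card A := by exact_mod_cast Fintype.card_pos
  rw [Finset.sum_const, Finset.card_univ, ← Nat.cast_smul_eq_nsmul ℝ, smul_smul, mul_inv_cancel₀ hcA.ne', one_smul]

lemma sum_fromBlocks {A p q : Type} [Fintype A] (E : A → Matrix p p ℂ) (F : A → Matrix q q ℂ) :
    ∑ a, fromBlocks (E a) 0 0 (F a) = fromBlocks (∑ a, E a) 0 0 (∑ a, F a) := by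
  ext i j
  rcases i with i | i <;> rcases j with j | j <;> simp [Matrix.sum_apply]

lemma padA_sum {A p q : Type} [Fintype A] [Nonempty A] [DecidableEq p] [DecidableEq q] (E : A → Matrix p p ℂ)
    (h : ∑ a, E a = 1) : ∑ a, padA (q := q) E a = 1 := by
  unfold padA
  rw [sum_fromBlocks, h, unif_sum, fromBlocks_one]

lemma padB_sum {B p q : Type} [Fintype B] [Nonempty B] [DecidableEq p] [DecidableEq q] (F : B → Matrix q q ℂ)
    (h : ∑ b, F b = 1) : ∑ b, padB (p := p) F b = 1 := by
  unfold padB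
  rw [sum_fromBlocks, ← transpose_sum, h, unif_sum, transpose_one, fromBlocks_one]

lemma padA_psd {A p q : Type} [Fintype A] [Fintype p] [Fintype q] [DecidableEq p] [DecidableEq q] (E : A → Matrix p p ℂ)
    (h : ∀ a, (E a).PosSemidef) (a : A) : (padA (q := q) E a).PosSemidef :=
  pad_psd (h a) (Matrix.PosSemidef.one.smul (inv_nonneg.mpr (Nat.cast_nonneg _)))

lemma padB_psd {B p q : Type} [Fintype B] [Fintype p] [Fintype q] [DecidableEq p] [DecidableEq q] (F : B → Matrix q q ℂ)
    (h : ∀ b, (F b).PosSemidef) (b : B) : (padB (p := p) F b).PosSemidef :=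
  pad_psd (Matrix.PosSemidef.one.smul (inv_nonneg.mpr (Nat.cast_nonneg _))) (h b).transpose

/-- padded state with diagonal perturbation -/
def padK {dA dB : ℕ} (ψ : Fin dA × Fin dB → ℂ) (η : ℝ) : Matrix (Fin dA ⊕ Fin dB) (Fin dA ⊕ Fin dB) ℂ :=
  fromBlocks (η • 1) (Matrix.of fun i j => ψ (i, j)) 0 (η • 1)

lemma padK_zero {dA dB : ℕ} (ψ : Fin dA × Fin dB → ℂ) :
    padK ψ 0 = fromBlocks 0 (Matrix.of fun i j => ψ (i, j)) 0 0 := by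
  simp [padK]

lemma padK_unit {dA dB : ℕ} (ψ : Fin dA × Fin dB → ℂ) {η : ℝ} (h : η ≠ 0) : IsUnit (padK ψ η) := by
  rw [Matrix.isUnit_iff_isUnit_det]
  unfold padK
  rw [det_fromBlocks_zero₂₁, isUnit_iff_ne_zero]
  have : ∀ d : ℕ, (η • (1 : Matrix (Fin d) (Fin d) ℂ)).det ≠ 0 := by
    intro d
    have e : η • (1 : Matrix (Fin d) (Fin d) ℂ) = (η : ℂ) • 1 := by
      ext i j; simp
    rw [e, det_smul, det_one, mul_one]
    exact pow_ne_zero _ (by exact_mod_cast h)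
  exact mul_ne_zero (this _) (this _)

lemma padK_norm {dA dB : ℕ} (ψ : Fin dA × Fin dB → ℂ) (h : star ψ ⬝ᵥ ψ = 1) : tau (padK ψ 0) 1 1 = 1 := by
  have := pad_term ψ 1 1 1 1
  rw [transpose_one, fromBlocks_one, one_kronecker_one, one_mulVec, h] at this
  rw [padK_zero, ← fromBlocks_one, fromBlocks_one] 
  exact this.symm

variable {X Y A B : Type} [Fintype X] [Fintype Y] [Fintype A] [Fintype B]

lemma winProb_pad (G : Game X Y A B) {dA dB : ℕ} (ψ : Fin dA × Fin dB → ℂ)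
    (Al : X → A → Matrix (Fin dA) (Fin dA) ℂ) (Bo : Y → B → Matrix (Fin dB) (Fin dB) ℂ) :
    winProb G ψ Al Bo = ∑ x, ∑ y, ∑ a, ∑ b, G.μ (x, y) * (if G.V x y a b then 1 else 0) *
      tau (padK ψ 0) (padA (Al x) a) (padB (Bo y) b) := by
  unfold winProb
  simp only [padK_zero, padA, padB, ← pad_term]

lemma winProb_le (G : Game X Y A B) [Nonempty A] [Nonempty B] {μX : X → ℝ} {μY : Y → ℝ}
    (hX : ∀ x, 0 ≤ μX x) (hX1 : ∑ x, μX x = 1) (hY : ∀ y, 0 ≤ μY y) (hY1 : ∑ y, μY y = 1)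
    (hμ : ∀ x y, G.μ (x, y) = μX x * μY y) {dA dB : ℕ} (ψ : Fin dA × Fin dB → ℂ) (hψ : star ψ ⬝ᵥ ψ = 1)
    (Al : X → A → Matrix (Fin dA) (Fin dA) ℂ) (Bo : Y → B → Matrix (Fin dB) (Fin dB) ℂ)
    (hA : ∀ x a, (Al x a).PosSemidef) (hA1 : ∀ x, ∑ a : A, Al x a = 1)
    (hB : ∀ y b, (Bo y b).PosSemidef) (hB1 : ∀ y, ∑ b : B, Bo y b = 1) :
    0 ≤ winProb G ψ Al Bo ∧ winProb G ψ Al Bo ≤ 1 := by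
  rw [winProb_pad]
  simp only [hμ]
  constructor
  · refine Finset.sum_nonneg fun x _ => Finset.sum_nonneg fun y _ => Finset.sum_nonneg fun a _ =>
      Finset.sum_nonneg fun b _ => mul_nonneg (mul_nonneg (mul_nonneg (hX x) (hY y)) (by split_ifs <;> norm_num))
        (tau_nonneg _ (padA_psd _ (hA x) a) (padB_psd _ (hB y) b))
  · have := gval_drop (v := fun x y a b => if G.V x y a b then (1:ℝ) else 0) hX hY
      (fun x y a b => by split_ifs <;> norm_num) (padK ψ 0) (fun x a => padA (Al x) a) (fun y b => padB (Bo y) b)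
      (fun x => padA_psd _ (hA x)) (fun y => padB_psd _ (hB y))
    refine this.trans (le_of_eq ?_)
    simp only [padA_sum _ (hA1 _), padB_sum _ (hB1 _), ← Finset.sum_smul, hX1, hY1, one_smul]
    exact padK_norm ψ hψ

lemma value_mem (G : Game X Y A B) [Nonempty A] [Nonempty B] {μX : X → ℝ} {μY : Y → ℝ}
    (hX : ∀ x, 0 ≤ μX x) (hX1 : ∑ x, μX x = 1) (hY : ∀ y, 0 ≤ μY y) (hY1 : ∑ y, μY y = 1)
    (hμ : ∀ x y, G.μ (x, y) = μX x * μY y) :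
    0 ≤ entangledValue G ∧ entangledValue G ≤ 1 := by
  constructor
  · refine Real.sSup_nonneg ?_
    rintro p ⟨dA, dB, ψ, Al, Bo, hψ, hA, hA1, hB, hB1, rfl⟩
    exact (winProb_le G hX hX1 hY hY1 hμ ψ hψ Al Bo hA hA1 hB hB1).1
  · refine Real.sSup_le ?_ zero_le_one
    rintro p ⟨dA, dB, ψ, Al, Bo, hψ, hA, hA1, hB, hB1, rfl⟩
    exact (winProb_le G hX hX1 hY hY1 hμ ψ hψ Al Bo hA hA1 hB hB1).2

lemma omegaBound (G : Game X Y A B) [Nonempty A] [Nonempty B] {μX : X → ℝ} {μY : Y → ℝ}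
    (hX : ∀ x, 0 ≤ μX x) (hX1 : ∑ x, μX x = 1) (hY : ∀ y, 0 ≤ μY y) (hY1 : ∑ y, μY y = 1)
    (hμ : ∀ x y, G.μ (x, y) = μX x * μY y) (n : Type) [Fintype n] [DecidableEq n] :
    OmegaBound n μX μY (fun x y a b => if G.V x y a b then (1:ℝ) else 0) (entangledValue G) := by
  intro K E F hE hF hE1 hF1
  set N := tau K 1 1 with hN
  have N0 : 0 ≤ N := tau_nonneg K Matrix.PosSemidef.one Matrix.PosSemidef.one
  rcases eq_or_lt_of_le N0 with h | hpos
  · rw [← h, mul_zero]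
    have := gval_drop (v := fun x y a b => if G.V x y a b then (1:ℝ) else 0) hX hY
      (fun x y a b => by split_ifs <;> norm_num) K E F hE hF
    simp only [hE1, hF1, ← Finset.sum_smul, hX1, hY1, one_smul] at this
    rw [← hN, ← h] at this
    exact this
  · let e := (Fintype.equivFin n).symm
    let d := Fintype.card n
    set r : ℝ := (Real.sqrt N)⁻¹ with hr
    have hr2 : r * r * N = 1 := by
      rw [hr, ← mul_inv, Real.mul_self_sqrt N0, inv_mul_cancel₀ hpos.ne']
    let M : Matrix (Fin d) (Fin d) ℂ := (r • K).submatrix e e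
    let ψ : Fin d × Fin d → ℂ := fun p => M p.1 p.2
    have term : ∀ P Q : Matrix n n ℂ, (star ψ ⬝ᵥ ((P.submatrix e e ⊗ₖ (Qᵀ).submatrix e e) *ᵥ ψ)).re = r * r * tau K P Q := by
      intro P Q
      rw [wp_trace M]
      have : Mᴴ * P.submatrix e e * M * ((Qᵀ).submatrix e e)ᵀ = ((r • K)ᴴ * P * (r • K) * Q).submatrix e e := by
        simp only [M, conjTranspose_submatrix, transpose_submatrix, transpose_transpose, submatrix_mul_equiv]
      rw [this]
      have t2 : ∀ Z : Matrix n n ℂ, trace (Z.submatrix e e) = trace Z := by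
        intro Z
        exact Equiv.sum_comp e (fun i => Z i i)
      rw [t2, tau, conjTranspose_smul, star_trivial]
      simp only [Matrix.smul_mul, Matrix.mul_smul, smul_smul]
      exact rt_smul _ _
    have hψ : star ψ ⬝ᵥ ψ = 1 := by
      have h1 := term 1 1
      rw [transpose_one, submatrix_one_equiv, one_kronecker_one, one_mulVec, ← hN, hr2] at h1
      have h2 : (star ψ ⬝ᵥ ψ).im = 0 := by
        have := dotProduct_star_self_nonneg ψ
        exact (Complex.le_def.mp this).2.symm
      exact Complex.ext (by simpa using h1) (by simpa using h2)
    have hw : winProb G ψ (fun x a => (E x a).submatrix e e) (fun y b => ((F y b)ᵀ).submatrix e e) =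
        r * r * gval μX μY (fun x y a b => if G.V x y a b then (1:ℝ) else 0) K E F := by
      unfold winProb gval
      simp only [term, hμ, Finset.mul_sum]
      refine Finset.sum_congr rfl fun x _ => Finset.sum_congr rfl fun y _ =>
        Finset.sum_congr rfl fun a _ => Finset.sum_congr rfl fun b _ => ?_
      ring
    have sub_sum : ∀ {ι : Type} [Fintype ι] (Z : ι → Matrix n n ℂ), ∑ i, (Z i).submatrix e e = (∑ i, Z i).submatrix e e := by
      intro ι _ Z
      ext i j; simp [Matrix.sum_apply]
    have mem : r * r * gval μX μY (fun x y a b => if G.V x y a b then (1:ℝ) else 0) K E F ≤ entangledValue G := by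
      refine le_csSup ⟨1, ?_⟩ ?_
      · rintro p ⟨dA, dB, ψ, Al, Bo, hψ, hA, hA1, hB, hB1, rfl⟩
        exact (winProb_le G hX hX1 hY hY1 hμ ψ hψ Al Bo hA hA1 hB hB1).2
      · refine ⟨d, d, ψ, _, _, hψ, fun x a => (hE x a).submatrix e, fun x => ?_,
          fun y b => (hF y b).transpose.submatrix e, fun y => ?_, hw.symm⟩
        · rw [sub_sum, hE1, submatrix_one_equiv]
        · rw [sub_sum, ← transpose_sum, hF1, transpose_one, submatrix_one_equiv]
    have := mul_le_mul_of_nonneg_right mem N0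
    calc _ = (r * r * N) * gval μX μY (fun x y a b => if G.V x y a b then (1:ℝ) else 0) K E F := by rw [hr2, one_mul]
      _ ≤ _ := by linarith
end RED

section FINAL
variable {X Y A B : Type} [Fintype X] [Fintype Y] [Fintype A] [Fintype B]

/-- perturbed measurement -/
def pert {I n : Type} [Fintype I] [DecidableEq n] (E : I → Matrix n n ℂ) (η : ℝ) (a : I) : Matrix n n ℂ :=
  (1 - η) • E a + η • ((Fintype.card I : ℝ)⁻¹ • 1)

lemma pert_zero {I n : Type} [Fintype I] [DecidableEq n] (E : I → Matrix n n ℂ) (a : I) : pert E 0 a = E a := by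
  simp [pert]

lemma pert_sum {I n : Type} [Fintype I] [Nonempty I] [DecidableEq n] (E : I → Matrix n n ℂ) (h : ∑ a, E a = 1) (η : ℝ) :
    ∑ a, pert E η a = 1 := by
  unfold pert
  rw [Finset.sum_add_distrib, ← Finset.smul_sum, ← Finset.smul_sum, unif_sum, h, ← add_smul]
  simp

lemma pert_posDef {I n : Type} [Fintype I] [Nonempty I] [Fintype n] [DecidableEq n] (E : I → Matrix n n ℂ)
    (h : ∀ a, (E a).PosSemidef) {η : ℝ} (h0 : 0 < η) (h1 : η ≤ 1) (a : I) : (pert E η a).PosDef := by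
  have hc : (0:ℝ) < Fintype.card I := by exact_mod_cast Fintype.card_pos
  unfold pert
  refine Matrix.PosDef.posSemidef_add ((h a).smul (by linarith)) ?_
  exact (Matrix.PosDef.one.smul (inv_pos.mpr hc)).smul h0

lemma pert_cont {I n : Type} [Fintype I] [DecidableEq n] (E : I → Matrix n n ℂ) (a : I) :
    Continuous (fun η => pert E η a) := by
  unfold pert
  fun_prop

lemma tau_cont {n : Type} [Fintype n] [DecidableEq n] {K P Q : ℝ → Matrix n n ℂ} (hK : Continuous K) (hP : Continuous P)
    (hQ : Continuous Q) : Continuous (fun η => tau (K η) (P η) (Q η)) := by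
  unfold tau rt
  exact Complex.continuous_re.comp
    ((((hK.matrix_conjTranspose.matrix_mul hP).matrix_mul hK).matrix_mul hQ).matrix_trace)

lemma padK_cont {dA dB : ℕ} (ψ : Fin dA × Fin dB → ℂ) : Continuous (padK ψ) := by
  unfold padK
  exact Continuous.matrix_fromBlocks (by fun_prop) continuous_const continuous_const (by fun_prop)

lemma pow_bound (G : Game X Y A B) [Nonempty A] [Nonempty B] {μX : X → ℝ} {μY : Y → ℝ}
    (hX : ∀ x, 0 ≤ μX x) (hX1 : ∑ x, μX x = 1) (hY : ∀ y, 0 ≤ μY y) (hY1 : ∑ y, μY y = 1)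
    (hμ : ∀ x y, G.μ (x, y) = μX x * μY y) (hcard : 2 ≤ Fintype.card A * Fintype.card B) {k : ℕ} (hk : 1 ≤ k)
    {dA dB : ℕ} (ψ : Fin dA × Fin dB → ℂ) (hψ : star ψ ⬝ᵥ ψ = 1)
    (Al : (Fin k → X) → (Fin k → A) → Matrix (Fin dA) (Fin dA) ℂ)
    (Bo : (Fin k → Y) → (Fin k → B) → Matrix (Fin dB) (Fin dB) ℂ)
    (hA : ∀ x a, (Al x a).PosSemidef) (hA1 : ∀ x, ∑ a, Al x a = 1)
    (hB : ∀ y b, (Bo y b).PosSemidef) (hB1 : ∀ y, ∑ b, Bo y b = 1) :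
    winProb (gamePow G k) ψ Al Bo ≤ (1 - (1 - entangledValue G) ^ 3) ^
                ((1/2000) * (k : ℝ) / Real.logb 2 ((Fintype.card A : ℝ) * Fintype.card B)) := by
  obtain ⟨w0, w1⟩ := value_mem G hX hX1 hY hY1 hμ
  set R := (1 - (1 - entangledValue G) ^ 3) ^
                ((1/2000) * (k : ℝ) / Real.logb 2 ((Fintype.card A : ℝ) * Fintype.card B)) with hR
  let AE : ℝ → (Fin k → X) → (Fin k → A) → Matrix (Fin dA ⊕ Fin dB) (Fin dA ⊕ Fin dB) ℂ :=
    fun η x a => pert (padA (Al x)) η a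
  let BE : ℝ → (Fin k → Y) → (Fin k → B) → Matrix (Fin dA ⊕ Fin dB) (Fin dA ⊕ Fin dB) ℂ :=
    fun η y b => pert (padB (Bo y)) η b
  have e0 : winProb (gamePow G k) ψ Al Bo = prC μX μY G.V (padK ψ 0) (AE 0) (BE 0) Finset.univ := by
    rw [winProb_pad]
    unfold prC Ex
    simp only [smul_eq_mul, Finset.mul_sum, AE, BE, pert_zero]
    refine Finset.sum_congr rfl fun x _ => Finset.sum_congr rfl fun y _ =>
      Finset.sum_congr rfl fun a _ => Finset.sum_congr rfl fun b _ => ?_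
    have h1 : (gamePow G k).μ (x, y) = pm μX x * pm μY y := by
      simp only [gamePow, hμ, pm, Finset.prod_mul_distrib]
    have h2 : (if (gamePow G k).V x y a b = true then (1:ℝ) else 0) =
        wn G.V (rs Finset.univ x) (rs Finset.univ y) (rs Finset.univ a) (rs Finset.univ b) := by
      unfold wn
      simp only [gamePow, decide_eq_true_eq, rs, Subtype.forall, Finset.mem_univ, forall_const]
    rw [h1, h2]
    ring
  have key : ∀ η : ℝ, 0 < η → η ≤ 1 →
      prC μX μY G.V (padK ψ η) (AE η) (BE η) Finset.univ ≤ tau (padK ψ η) 1 1 * R := by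
    intro η h0 h1
    have pA : ∀ x a, (AE η x a).PosDef := fun x a => pert_posDef _ (padA_psd _ (hA x)) h0 h1 a
    have pB : ∀ y b, (BE η y b).PosDef := fun y b => pert_posDef _ (padB_psd _ (hB y)) h0 h1 b
    have sA : ∀ x, ∑ a, AE η x a = 1 := fun x => pert_sum _ (padA_sum _ (hA1 x)) η
    have sB : ∀ y, ∑ b, BE η y b = 1 := fun y => pert_sum _ (padB_sum _ (hB1 y)) η
    have N0 : 0 ≤ tau (padK ψ η) 1 1 := tau_nonneg _ Matrix.PosSemidef.one Matrix.PosSemidef.one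
    rcases eq_or_lt_of_le N0 with h | hN
    · rw [← h, zero_mul]
      refine (prC_mono hX hY (fun x a => (pA x a).posSemidef) (fun y b => (pB y b).posSemidef) ∅).trans ?_
      rw [prC_empty hX1 hY1 sA sB, ← h]
    · exact nice_bound (omegaBound G hX hX1 hY hY1 hμ _) w0 w1 hX hX1 hY hY1 (padK_unit ψ h0.ne') pA pB sA sB hN hk hcard
  have cL : Continuous (fun η => prC μX μY G.V (padK ψ η) (AE η) (BE η) Finset.univ) := by
    unfold prC Ex
    simp only [smul_eq_mul]
    refine continuous_finsetSum _ fun x _ => ?_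
    refine Continuous.mul continuous_const ?_
    refine continuous_finsetSum _ fun y _ => ?_
    refine Continuous.mul continuous_const ?_
    refine continuous_finsetSum _ fun a _ => ?_
    refine continuous_finsetSum _ fun b _ => ?_
    exact Continuous.mul continuous_const (tau_cont (padK_cont ψ) (pert_cont _ _) (pert_cont _ _))
  have cR : Continuous (fun η => tau (padK ψ η) 1 1 * R) :=
    (tau_cont (padK_cont ψ) continuous_const continuous_const).mul continuous_const
  have lim := le_of_tendsto_of_tendsto (b := nhdsWithin (0:ℝ) (Set.Ioi 0))
    ((cL.tendsto 0).mono_left nhdsWithin_le_nhds)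
    ((cR.tendsto 0).mono_left nhdsWithin_le_nhds) (by
      filter_upwards [Ioc_mem_nhdsGT (show (0:ℝ) < 1 by norm_num)] with η hη
      exact key η hη.1 hη.2)
  rw [e0]
  refine lim.trans (le_of_eq ?_)
  rw [padK_norm ψ hψ, one_mul]
end FINAL

theorem parallel_repetition_product :
    ∃ c : ℝ, 0 < c ∧
      ∀ (X Y A B : Type) (_ : Fintype X) (_ : Fintype Y) (_ : Fintype A) (_ : Fintype B)
        (_ : Nonempty X) (_ : Nonempty Y) (_ : Nonempty A) (_ : Nonempty B)
        (G : Game X Y A B),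
        (∀ p, 0 ≤ G.μ p) → (∑ p : X × Y, G.μ p = 1) →
        ∀ (μX : X → ℝ) (μY : Y → ℝ),
          (∀ x, 0 ≤ μX x) → (∑ x : X, μX x = 1) →
          (∀ y, 0 ≤ μY y) → (∑ y : Y, μY y = 1) →
          (∀ x y, G.μ (x, y) = μX x * μY y) →
          2 ≤ Fintype.card A * Fintype.card B →
          ∀ k : ℕ, 1 ≤ k →
            entangledValue (gamePow G k) ≤
              (1 - (1 - entangledValue G) ^ 3) ^
                (c * (k : ℝ) / Real.logb 2 ((Fintype.card A : ℝ) * Fintype.card B)) := by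
  refine ⟨1/2000, by norm_num, ?_⟩
  intro X Y A B _ _ _ _ _ _ _ _ G _ _ μX μY hX hX1 hY hY1 hμ hcard k hk
  obtain ⟨w0, w1⟩ := value_mem G hX hX1 hY hY1 hμ
  refine Real.sSup_le ?_ (Real.rpow_nonneg ?_ _)
  · rintro p ⟨dA, dB, ψ, Al, Bo, hψ, hA, hA1, hB, hB1, rfl⟩
    exact pow_bound G hX hX1 hY hY1 hμ hcard hk ψ hψ Al Bo hA hA1 hB hB1
  · have : (1 - entangledValue G) ^ 3 ≤ 1 := pow_le_one₀ (by linarith) (by linarith)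
    linarith
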